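/- arXiv:2311.01791 — 2 statements merged into one kernel-verified Lean document; each statement's English description precedes it below -/
import Mathlib

section
/- Set e_i := x_{i+1,0} ∈ S for i ≥ 1. Let 𝔏 be the S-module (S/I₁)·u₁ ⊕ (S/I₁)·u₂ ⊕ (S/I₂)·u₃ ⊕ (S/I₃)·u₄, where I₁ is the ideal of S generated by e₁³, by all products e_α e_β with α, β ≥ 1 except α = β = 1, and by all e_γ with γ ≥ 4; I₂ is generated by all e_α with α ≥ 3 and all products e_β e_γ with β, γ ≥ 1; and I₃ is generated by all e_α with α ≥ 2 and all products e_β e_γ with β, γ ≥ 1. Let 𝔎 ⊆ 𝔏 be the ℚ-subspace spanned by the three elements 2e₂u₃ + 3e₁u₄, e₂u₂ + 6e₁u₃, and e₃u₂ − 6e₁²u₁ (each of which spans a trivial S-submodule of 𝔏). Then there is an isomorphism of S-modules R_∞^{(4)}/D_∞(R_∞^{(5)}) ≅ 𝔏/𝔎 sending the classes of x_{4,4}, x_{2,2}², x_{3,3}·x_{2,1}, x_{3,3}·x_{3,1} to u₁, u₂, u₃, u₄ respectively. (This is the algebraic form of the theorem computing H_st^even(Λ⁵H̃_ℚ), with u₁,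 u₂, u₃, u₄ corresponding to m̄_{0,4}, m̄_{0,2}m̄_{0,2}, m̄_{0,3}m̄_{1,1}, m̄_{0,3}m̄_{2,1}.) -/
open MvPolynomial

noncomputable section

/-- The index set `{(n,k) : 2 ≤ n, 0 ≤ k ≤ n}` of the variables `x_{n,k}` of `R_∞`. -/
abbrev Idx : Type := {p : ℕ × ℕ // 2 ≤ p.1 ∧ p.2 ≤ p.1}

/-- The polynomial ring `R_∞ = ℚ[x_{n,k} : n ≥ 2, 0 ≤ k ≤ n]`. -/
abbrev Rinf : Type := MvPolynomial Idx ℚ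

/-- The variable `x_{n,k}` (and `0` for out-of-range indices, which never occur below). -/
def xv (n k : ℕ) : Rinf := if h : 2 ≤ n ∧ k ≤ n then X ⟨(n, k), h⟩ else 0

/-- The derivation `D_∞` with `D_∞(x_{n,k}) = x_{n,k−1}` for `1 ≤ k ≤ n` and
`D_∞(x_{n,0}) = 0`. -/
def Dinf : Derivation ℚ Rinf Rinf :=
  MvPolynomial.mkDerivation ℚ fun s : Idx =>
    if s.1.2 = 0 then 0 else xv s.1.1 (s.1.2 - 1)

/-- The weight `wt(x_{n,k}) = k`. -/
def wt : Idx → ℕ := fun s => s.1.2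

/-- `R_∞^{(d)}`: the `ℚ`-span of the monomials of weight `d`. -/
def W (d : ℕ) : Submodule ℚ Rinf := weightedHomogeneousSubmodule ℚ wt d

/-- `S = R_∞^{(0)} = ℚ[x_{n,0} : n ≥ 2]`, as a subalgebra of `R_∞`. -/
def SAlg : Subalgebra ℚ Rinf := Algebra.adjoin ℚ {f : Rinf | ∃ n, 2 ≤ n ∧ f = xv n 0}

lemma xv0_mem (n : ℕ) : xv n 0 ∈ SAlg := by
  by_cases h : 2 ≤ n
  · exact Algebra.subset_adjoin ⟨n, h, rfl⟩
  · have hz : xv n 0 = 0 := by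
      rw [xv, dif_neg]
      exact fun hc => h hc.1
    rw [hz]
    exact Subalgebra.zero_mem _

/-- The element `e_i = x_{i+1,0}` of `S`; below `eS n` denotes `x_{n,0} ∈ S`, so that the
class `e_i` of the paper is `eS (i+1)`. -/
def eS (n : ℕ) : SAlg := ⟨xv n 0, xv0_mem n⟩

/-- The ideal `I₁ = (e₁³, e_α e_β (α,β ≥ 1, (α,β) ≠ (1,1)), e_γ (γ ≥ 4))` of `S`,
where `e_i = eS (i+1)`. -/
def I₁ : Ideal SAlg :=
  Ideal.span
    (insert ((eS 2) ^ 3)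
      ({g : SAlg | ∃ α β, 1 ≤ α ∧ 1 ≤ β ∧ ¬(α = 1 ∧ β = 1) ∧ g = eS (α + 1) * eS (β + 1)} ∪
       {g : SAlg | ∃ γ, 4 ≤ γ ∧ g = eS (γ + 1)}))

/-- The ideal `I₂ = (e_α (α ≥ 3), e_β e_γ (β,γ ≥ 1))` of `S`. -/
def I₂ : Ideal SAlg :=
  Ideal.span
    ({g : SAlg | ∃ α, 3 ≤ α ∧ g = eS (α + 1)} ∪
     {g : SAlg | ∃ β γ, 1 ≤ β ∧ 1 ≤ γ ∧ g = eS (β + 1) * eS (γ + 1)})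

/-- The ideal `I₃ = (e_α (α ≥ 2), e_β e_γ (β,γ ≥ 1))` of `S`. -/
def I₃ : Ideal SAlg :=
  Ideal.span
    ({g : SAlg | ∃ α, 2 ≤ α ∧ g = eS (α + 1)} ∪
     {g : SAlg | ∃ β γ, 1 ≤ β ∧ 1 ≤ γ ∧ g = eS (β + 1) * eS (γ + 1)})

/-- The images of `m̄_{0,4}, m̄_{0,2}², m̄_{0,3}m̄_{1,1}, m̄_{0,3}m̄_{2,1}` in `R_∞`. -/
def gen5 : Fin 4 → Rinf :=
  ![xv 4 4, xv 2 2 ^ 2, xv 3 3 * xv 2 1, xv 3 3 * xv 3 1]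

/-! ### Basic facts -/

lemma xv_eq {n k : ℕ} (h : 2 ≤ n ∧ k ≤ n) : xv n k = X ⟨(n, k), h⟩ := by
  rw [xv, dif_pos h]

lemma xv_zero {n k : ℕ} (h : ¬ (2 ≤ n ∧ k ≤ n)) : xv n k = 0 := by
  rw [xv, dif_neg h]

lemma X_eq (s : Idx) : (X s : Rinf) = xv s.1.1 s.1.2 := by
  rw [xv_eq s.2]

lemma D_xv {n k : ℕ} (h : k + 1 ≤ n) : Dinf (xv n (k + 1)) = xv n k := by
  by_cases hn : 2 ≤ n
  · rw [xv_eq ⟨hn, h⟩, Dinf, mkDerivation_X]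
    simp
  · rw [xv_zero (by omega), xv_zero (by omega), map_zero]

lemma D_xv0 (n : ℕ) : Dinf (xv n 0) = 0 := by
  by_cases hn : 2 ≤ n
  · rw [xv_eq ⟨hn, by omega⟩, Dinf, mkDerivation_X]
    simp
  · rw [xv_zero (by omega), map_zero]

lemma xv_mem (n k : ℕ) : xv n k ∈ W k := by
  by_cases h : 2 ≤ n ∧ k ≤ n
  · rw [xv_eq h]
    exact isWeightedHomogeneous_X ℚ wt ⟨(n, k), h⟩
  · rw [xv_zero h]; exact Submodule.zero_mem _

lemma W_mul {a b : ℕ} {f g : Rinf} (hf : f ∈ W a) (hg : g ∈ W b) : f * g ∈ W (a + b) :=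
  IsWeightedHomogeneous.mul hf hg

lemma W_one : (1 : Rinf) ∈ W 0 := isWeightedHomogeneous_one ℚ wt

lemma S_mem_W (s : SAlg) : (s : Rinf) ∈ W 0 := by
  obtain ⟨s, hs⟩ := s
  change s ∈ W 0
  induction hs using Algebra.adjoin_induction with
  | mem x hx => obtain ⟨n, _, rfl⟩ := hx; exact xv_mem n 0
  | algebraMap r =>
    rw [Algebra.algebraMap_eq_smul_one]
    exact Submodule.smul_mem _ _ W_one
  | add x y _ _ hx hy => exact Submodule.add_mem _ hx hy
  | mul x y _ _ hx hy => exact W_mul hx hy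

lemma D_S (s : SAlg) : Dinf (s : Rinf) = 0 := by
  obtain ⟨s, hs⟩ := s
  change Dinf s = 0
  induction hs using Algebra.adjoin_induction with
  | mem x hx => obtain ⟨n, _, rfl⟩ := hx; exact D_xv0 n
  | algebraMap r => exact Derivation.map_algebraMap _ _
  | add x y _ _ hx hy => rw [map_add, hx, hy, add_zero]
  | mul x y _ _ hx hy => rw [Derivation.leibniz, hx, hy]; simp

/-- The image of `D` in weight four. -/
def Im : Submodule ℚ Rinf := Submodule.map Dinf.toLinearMap (W 5)

lemma D_mem {g : Rinf} (h : g ∈ W 5) : Dinf g ∈ Im := ⟨g, h, rfl⟩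

lemma Im_smul (s : SAlg) {f : Rinf} (h : f ∈ Im) : (s : Rinf) * f ∈ Im := by
  obtain ⟨g, hg, rfl⟩ := h
  refine ⟨s * g, ?_, ?_⟩
  · have := W_mul (S_mem_W s) hg
    rwa [zero_add] at this
  · change Dinf (s * g) = s * Dinf g
    rw [Derivation.leibniz, D_S]; simp

/-! ### Surjectivity -/

/-- Elements congruent to an `S`-combination of the generators. -/
def Q : Submodule ℚ Rinf where
  carrier := {f | ∃ s : Fin 4 → SAlg, f - ∑ i, (s i : Rinf) * gen5 i ∈ Im}
  zero_mem' := ⟨0, by simp⟩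
  add_mem' := by
    rintro f g ⟨s, hs⟩ ⟨t, ht⟩
    refine ⟨s + t, ?_⟩
    have := Submodule.add_mem _ hs ht
    convert this using 1
    simp only [Pi.add_apply, Subalgebra.coe_add, add_mul, Finset.sum_add_distrib]
    ring
  smul_mem' := by
    rintro c f ⟨s, hs⟩
    refine ⟨c • s, ?_⟩
    have := Submodule.smul_mem _ c hs
    convert this using 1
    simp only [Pi.smul_apply, Subalgebra.coe_smul, smul_mul_assoc, smul_sub, Finset.smul_sum]

lemma Im_le_Q {f : Rinf} (h : f ∈ Im) : f ∈ Q := ⟨0, by simpa using h⟩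

lemma Q_smul {s : Rinf} (hs : s ∈ SAlg) {f : Rinf} (h : f ∈ Q) : s * f ∈ Q := by
  obtain ⟨t, ht⟩ := h
  refine ⟨fun i => ⟨s, hs⟩ * t i, ?_⟩
  have := Im_smul ⟨s, hs⟩ ht
  convert this using 1
  simp only [Subalgebra.coe_mul, mul_sub, Finset.mul_sum, mul_assoc]

lemma Q_gen (i : Fin 4) : gen5 i ∈ Q := by
  refine ⟨Pi.single i 1, ?_⟩
  have : ∑ j, ((Pi.single i (1 : SAlg) : Fin 4 → SAlg) j : Rinf) * gen5 j = gen5 i := by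
    rw [Finset.sum_eq_single i]
    · simp
    · intro j _ hj; simp [hj]
    · simp
  rw [this, sub_self]
  exact Submodule.zero_mem _

lemma Q_xv (n : ℕ) {f : Rinf} (h : f ∈ Q) : xv n 0 * f ∈ Q := Q_smul (xv0_mem n) h

lemma Q1 (a : ℕ) : xv a 4 ∈ Q := by
  rcases lt_trichotomy a 4 with h | h | h
  · rw [xv_zero (by omega)]; exact Submodule.zero_mem _
  · subst h; exact Q_gen 0
  · rw [← D_xv (show 4 + 1 ≤ a by omega)]
    exact Im_le_Q (D_mem (xv_mem a 5))

lemma D2 (a b i j : ℕ) (h : i + j = 5) : Dinf (xv a i * xv b j) ∈ Q := by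
  have := W_mul (xv_mem a i) (xv_mem b j)
  rw [h] at this
  exact Im_le_Q (D_mem this)

lemma D3 (a b c i j k : ℕ) (h : i + j + k = 5) : Dinf (xv a i * xv b j * xv c k) ∈ Q := by
  have := W_mul (W_mul (xv_mem a i) (xv_mem b j)) (xv_mem c k)
  rw [h] at this
  exact Im_le_Q (D_mem this)

lemma D4 (a b c d i j k l : ℕ) (h : i + j + k + l = 5) :
    Dinf (xv a i * xv b j * xv c k * xv d l) ∈ Q := by
  have := W_mul (W_mul (W_mul (xv_mem a i) (xv_mem b j)) (xv_mem c k)) (xv_mem d l)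
  rw [h] at this
  exact Im_le_Q (D_mem this)

lemma Q31a (a b : ℕ) (ha : 4 ≤ a) (hb : 1 ≤ b) : xv a 3 * xv b 1 ∈ Q := by
  have h := D2 a b 4 1 rfl
  rw [Derivation.leibniz, D_xv (show 3 + 1 ≤ a by omega), D_xv (show 0 + 1 ≤ b by omega)] at h
  have h2 := Submodule.sub_mem _ h (Q_xv b (Q1 a))
  convert h2 using 1
  simp only [smul_eq_mul]; ring

lemma Q31 (a b : ℕ) (ha : 3 ≤ a) (hb : 2 ≤ b) : xv a 3 * xv b 1 ∈ Q := by
  by_cases h4 : 4 ≤ a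
  · exact Q31a a b h4 (by omega)
  obtain rfl : a = 3 := by omega
  by_cases hb4 : 4 ≤ b
  · have h := D2 3 b 3 2 rfl
    have h' := D2 3 b 2 3 rfl
    rw [Derivation.leibniz, D_xv (show 2 + 1 ≤ 3 by omega), D_xv (show 1 + 1 ≤ b by omega)] at h
    rw [Derivation.leibniz, D_xv (show 1 + 1 ≤ 3 by omega), D_xv (show 2 + 1 ≤ b by omega)] at h'
    have h2 := Submodule.add_mem _ (Submodule.sub_mem _ h h') (Q31a b 3 hb4 (by omega))
    convert h2 using 1
    simp only [smul_eq_mul]; ring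
  · have : b = 2 ∨ b = 3 := by omega
    rcases this with rfl | rfl
    · exact Q_gen 2
    · exact Q_gen 3

lemma Q22a (a b : ℕ) (ha : 3 ≤ a) (hb : 2 ≤ b) : xv a 2 * xv b 2 ∈ Q := by
  have h := D2 a b 3 2 rfl
  rw [Derivation.leibniz, D_xv (show 2 + 1 ≤ a by omega), D_xv (show 1 + 1 ≤ b by omega)] at h
  have h2 := Submodule.sub_mem _ h (Q31 a b ha hb)
  convert h2 using 1
  simp only [smul_eq_mul]; ring

lemma Q22 (a b : ℕ) (ha : 2 ≤ a) (hb : 2 ≤ b) : xv a 2 * xv b 2 ∈ Q := by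
  by_cases h3 : 3 ≤ a
  · exact Q22a a b h3 hb
  by_cases h4 : 3 ≤ b
  · rw [mul_comm]; exact Q22a b a h4 ha
  obtain rfl : a = 2 := by omega
  obtain rfl : b = 2 := by omega
  have := Q_gen 1
  convert this using 1
  simp [gen5, sq]

lemma Q211a (a b c : ℕ) (ha : 3 ≤ a) (hb : 2 ≤ b) (hc : 2 ≤ c) :
    xv a 2 * xv b 1 * xv c 1 ∈ Q := by
  have h := D3 a b c 3 1 1 rfl
  rw [Derivation.leibniz, Derivation.leibniz, D_xv (show 2 + 1 ≤ a by omega),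
    D_xv (show 0 + 1 ≤ b by omega), D_xv (show 0 + 1 ≤ c by omega)] at h
  have h2 := Submodule.sub_mem _ (Submodule.sub_mem _ h (Q_xv b (Q31 a c ha hc)))
    (Q_xv c (Q31 a b ha hb))
  convert h2 using 1
  simp only [smul_eq_mul]; ring

lemma Q211b (b c : ℕ) (hb : 3 ≤ b) (hc : 2 ≤ c) :
    xv 2 2 * xv b 1 * xv c 1 ∈ Q := by
  have h := D3 2 b c 2 2 1 rfl
  rw [Derivation.leibniz, Derivation.leibniz, D_xv (show 1 + 1 ≤ 2 by omega),
    D_xv (show 1 + 1 ≤ b by omega), D_xv (show 0 + 1 ≤ c by omega)] at h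
  have h2 := Submodule.sub_mem _ (Submodule.sub_mem _ h (Q_xv c (Q22 2 b le_rfl (by omega))))
    (Q211a b 2 c hb le_rfl hc)
  convert h2 using 1
  simp only [smul_eq_mul]; ring

lemma Q211 (a b c : ℕ) (ha : 2 ≤ a) (hb : 2 ≤ b) (hc : 2 ≤ c) :
    xv a 2 * xv b 1 * xv c 1 ∈ Q := by
  by_cases h3 : 3 ≤ a
  · exact Q211a a b c h3 hb hc
  obtain rfl : a = 2 := by omega
  by_cases h4 : 3 ≤ b
  · exact Q211b b c h4 hc
  by_cases h5 : 3 ≤ c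
  · rw [mul_right_comm]; exact Q211b c b h5 hb
  obtain rfl : b = 2 := by omega
  obtain rfl : c = 2 := by omega
  have h := D3 2 2 2 2 2 1 rfl
  rw [Derivation.leibniz, Derivation.leibniz, D_xv (show 1 + 1 ≤ 2 by omega),
    D_xv (show 0 + 1 ≤ 2 by omega)] at h
  have h2 := Submodule.smul_mem _ (1 / 2 : ℚ)
    (Submodule.sub_mem _ h (Q_xv 2 (Q22 2 2 le_rfl le_rfl)))
  convert h2 using 1
  simp only [smul_eq_mul, smul_eq_C_mul]
  have : (C (1 / 2 : ℚ) : Rinf) * 2 = 1 := by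
    rw [show (2 : Rinf) = C 2 from (map_ofNat C 2).symm, ← C_mul]; norm_num
  linear_combination (-xv 2 2 * xv 2 1 * xv 2 1) * this

lemma Q1111 (a b c d : ℕ) (ha : 2 ≤ a) (hb : 2 ≤ b) (hc : 2 ≤ c) (hd : 2 ≤ d) :
    xv a 1 * xv b 1 * xv c 1 * xv d 1 ∈ Q := by
  have h := D4 a b c d 2 1 1 1 rfl
  rw [Derivation.leibniz, Derivation.leibniz, Derivation.leibniz, D_xv (show 1 + 1 ≤ a by omega),
    D_xv (show 0 + 1 ≤ b by omega), D_xv (show 0 + 1 ≤ c by omega),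
    D_xv (show 0 + 1 ≤ d by omega)] at h
  have h2 := Submodule.sub_mem _ (Submodule.sub_mem _ (Submodule.sub_mem _ h
    (Q_xv b (Q211 a c d ha hc hd))) (Q_xv c (Q211 a b d ha hb hd))) (Q_xv d (Q211 a b c ha hb hc))
  convert h2 using 1
  simp only [smul_eq_mul]; ring

lemma mono_zero (m : Idx →₀ ℕ) (h : Finsupp.weight wt m = 0) : (monomial m 1 : Rinf) ∈ SAlg := by
  rw [monomial_eq, C_1, one_mul]
  refine Subalgebra.prod_mem _ fun s hs => Subalgebra.pow_mem _ ?_ _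
  have h1 := Finsupp.le_weight_of_ne_zero' wt (Finsupp.mem_support_iff.mp hs)
  rw [h] at h1
  have h2 : s.1.2 = 0 := Nat.le_zero.mp h1
  rw [X_eq, h2]
  exact xv0_mem _

lemma mono_succ (m : Idx →₀ ℕ) (d : ℕ) (h : Finsupp.weight wt m = d) (hd : d ≠ 0) :
    ∃ (n k : ℕ) (m' : Idx →₀ ℕ), 2 ≤ n ∧ k ≤ n ∧ 1 ≤ k ∧ k + Finsupp.weight wt m' = d ∧
      (monomial m 1 : Rinf) = xv n k * monomial m' 1 := by
  have hex : ∃ s, m s ≠ 0 ∧ wt s ≠ 0 := by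
    by_contra! hc
    apply hd
    rw [← h, Finsupp.weight_apply]
    refine Finset.sum_eq_zero fun s hs => ?_
    change m s • wt s = 0
    rw [hc s (Finsupp.mem_support_iff.mp hs), smul_zero]
  obtain ⟨s, hs, hw⟩ := hex
  have hm : m = Finsupp.single s 1 + (m - Finsupp.single s 1) := by
    rw [add_tsub_cancel_of_le]
    rw [Finsupp.single_le_iff]
    omega
  refine ⟨s.1.1, s.1.2, m - Finsupp.single s 1, s.2.1, s.2.2, Nat.one_le_iff_ne_zero.mpr hw, ?_, ?_⟩
  · rw [← h]
    conv_rhs => rw [hm]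
    rw [map_add, Finsupp.weight_single, one_smul]
    rfl
  · conv_lhs => rw [hm]
    rw [← X_eq, X, monomial_mul, one_mul]

lemma Q_mono (m : Idx →₀ ℕ) (h : Finsupp.weight wt m = 4) : (monomial m 1 : Rinf) ∈ Q := by
  obtain ⟨a, i, m1, ha, hia, hi, hw, he⟩ := mono_succ m 4 h (by norm_num)
  rw [he]
  by_cases h1 : Finsupp.weight wt m1 = 0
  · obtain rfl : i = 4 := by omega
    rw [mul_comm]
    exact Q_smul (mono_zero m1 h1) (Q1 a)
  obtain ⟨b, j, m2, hb, hjb, hj, hw2, he2⟩ := mono_succ m1 _ rfl h1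
  rw [he2]
  by_cases h2 : Finsupp.weight wt m2 = 0
  · rw [← mul_assoc, mul_comm]
    refine Q_smul (mono_zero m2 h2) ?_
    have : (i = 1 ∧ j = 3) ∨ (i = 2 ∧ j = 2) ∨ (i = 3 ∧ j = 1) := by omega
    rcases this with ⟨rfl, rfl⟩ | ⟨rfl, rfl⟩ | ⟨rfl, rfl⟩
    · rw [mul_comm]; exact Q31 b a hjb ha
    · exact Q22 a b ha hb
    · exact Q31 a b hia hb
  obtain ⟨c, k, m3, hc, hkc, hk, hw3, he3⟩ := mono_succ m2 _ rfl h2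
  rw [he3]
  by_cases h3 : Finsupp.weight wt m3 = 0
  · rw [← mul_assoc, ← mul_assoc, mul_comm]
    refine Q_smul (mono_zero m3 h3) ?_
    have : (i = 1 ∧ j = 1 ∧ k = 2) ∨ (i = 1 ∧ j = 2 ∧ k = 1) ∨ (i = 2 ∧ j = 1 ∧ k = 1) := by omega
    rcases this with ⟨rfl, rfl, rfl⟩ | ⟨rfl, rfl, rfl⟩ | ⟨rfl, rfl, rfl⟩
    · have := Q211 c a b hc ha hb
      convert this using 1; ring
    · have := Q211 b a c hb ha hc
      convert this using 1; ring
    · exact Q211 a b c ha hb hc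
  obtain ⟨d, l, m4, hd, hld, hl, hw4, he4⟩ := mono_succ m3 _ rfl h3
  rw [he4]
  obtain ⟨rfl, rfl, rfl, rfl, h4⟩ :
    i = 1 ∧ j = 1 ∧ k = 1 ∧ l = 1 ∧ Finsupp.weight wt m4 = 0 := by omega
  have := Q_smul (mono_zero m4 h4) (Q1111 a b c d ha hb hc hd)
  convert this using 1; ring

lemma W_le_Q : W 4 ≤ Q := by
  intro f hf
  rw [← support_sum_monomial_coeff f]
  refine Submodule.sum_mem _ fun m hm => ?_
  have : (monomial m (coeff m f) : Rinf) = coeff m f • monomial m 1 := by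
    rw [smul_monomial, smul_eq_mul, mul_one]
  rw [this]
  exact Submodule.smul_mem _ _ (Q_mono m (hf (mem_support_iff.mp hm)))

/-! ### The `sl₂` argument -/

/-- The raising operator. -/
def Einf : Derivation ℚ Rinf Rinf :=
  MvPolynomial.mkDerivation ℚ fun s : Idx =>
    (((s.1.2 : ℚ) + 1) * ((s.1.1 : ℚ) - s.1.2)) • xv s.1.1 (s.1.2 + 1)

/-- The Cartan operator. -/
def Hinf : Derivation ℚ Rinf Rinf :=
  MvPolynomial.mkDerivation ℚ fun s : Idx =>
    ((s.1.1 : ℚ) - 2 * s.1.2) • xv s.1.1 s.1.2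

lemma E_xv (n k : ℕ) (h : 2 ≤ n ∧ k ≤ n) :
    Einf (xv n k) = (((k : ℚ) + 1) * ((n : ℚ) - k)) • xv n (k + 1) := by
  rw [xv_eq h, Einf, mkDerivation_X]

lemma H_xv (n k : ℕ) : Hinf (xv n k) = ((n : ℚ) - 2 * k) • xv n k := by
  by_cases h : 2 ≤ n ∧ k ≤ n
  · rw [xv_eq h, Hinf, mkDerivation_X, xv_eq h]
  · rw [xv_zero h, map_zero, smul_zero]

lemma bracket_eq : ⁅Dinf, Einf⁆ = Hinf := by
  refine derivation_ext fun s => ?_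
  obtain ⟨⟨n, k⟩, h⟩ := s
  rw [X_eq, H_xv, Derivation.commutator_apply]
  dsimp only at h ⊢
  rw [E_xv n k h, Derivation.map_smul]
  have h1 : (((k : ℚ) + 1) * ((n : ℚ) - k)) • Dinf (xv n (k + 1))
      = (((k : ℚ) + 1) * ((n : ℚ) - k)) • xv n k := by
    by_cases hk : k + 1 ≤ n
    · rw [D_xv hk]
    · have : k = n := by omega
      subst this
      simp
  rw [h1]
  rcases k with _ | k
  · rw [D_xv0, map_zero]; simp
  · rw [D_xv h.2, E_xv n k ⟨h.1, by omega⟩, ← sub_smul]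
    congr 1
    push_cast; ring

lemma DE (f : Rinf) : Dinf (Einf f) = Einf (Dinf f) + Hinf f := by
  rw [← bracket_eq, Derivation.commutator_apply]; ring

/-- Bihomogeneous elements. -/
inductive Bi : ℤ → ℤ → Rinf → Prop
  | one : Bi 0 0 1
  | zero (w N : ℤ) : Bi w N 0
  | mulx (w N : ℤ) (f : Rinf) (n k : ℕ) : Bi w N f → Bi (w + k) (N + n) (xv n k * f)
  | add (w N : ℤ) (f g : Rinf) : Bi w N f → Bi w N g → Bi w N (f + g)
  | smul (w N : ℤ) (c : ℚ) (f : Rinf) : Bi w N f → Bi w N (c • f)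

lemma Bi.cast {w w' N N' : ℤ} {f : Rinf} (h : Bi w N f) (hw : w = w') (hN : N = N') :
    Bi w' N' f := by subst hw; subst hN; exact h

lemma Bi.neg {w N : ℤ} {f : Rinf} (h : Bi w N f) : w < 0 → f = 0 := by
  induction h with
  | one => intro h; omega
  | zero w N => intro _; rfl
  | mulx w N f n k _ ih => intro h; rw [ih (by omega), mul_zero]
  | add w N f g _ _ ih1 ih2 => intro h; rw [ih1 h, ih2 h, add_zero]
  | smul w N c f _ ih => intro h; rw [ih h, smul_zero]

lemma Bi.memW {w N : ℤ} {f : Rinf} (h : Bi w N f) : ∀ d : ℕ, w = d → f ∈ W d := by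
  induction h with
  | one => intro d hd; obtain rfl : d = 0 := by omega
           exact W_one
  | zero w N => intro _ _; exact Submodule.zero_mem _
  | mulx w N f n k hf ih =>
    intro d hd
    by_cases hw : w < 0
    · rw [hf.neg hw, mul_zero]; exact Submodule.zero_mem _
    · have := W_mul (xv_mem n k) (ih w.toNat (by omega))
      rwa [show k + w.toNat = d by omega] at this
  | add w N f g _ _ ih1 ih2 => intro d h; exact Submodule.add_mem _ (ih1 d h) (ih2 d h)
  | smul w N c f _ ih => intro d h; exact Submodule.smul_mem _ _ (ih d h)

lemma Bi.D {w N : ℤ} {f : Rinf} (h : Bi w N f) : Bi (w - 1) N (Dinf f) := by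
  induction h with
  | one => rw [Derivation.map_one_eq_zero]; exact Bi.zero _ _
  | zero w N => rw [map_zero]; exact Bi.zero _ _
  | mulx w N f n k hf ih =>
    rw [Derivation.leibniz, smul_eq_mul, smul_eq_mul]
    refine Bi.add _ _ _ _ ((Bi.mulx _ _ _ n k ih).cast (by ring) rfl) ?_
    by_cases hk : k ≤ n
    · rcases k with _ | k
      · rw [D_xv0, mul_zero]; exact Bi.zero _ _
      · rw [D_xv hk, mul_comm]
        exact (Bi.mulx _ _ _ n k hf).cast (by push_cast; ring) rfl
    · rw [xv_zero (by omega), map_zero, mul_zero]; exact Bi.zero _ _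
  | add w N f g _ _ ih1 ih2 => rw [map_add]; exact Bi.add _ _ _ _ ih1 ih2
  | smul w N c f _ ih => rw [Derivation.map_smul]; exact Bi.smul _ _ _ _ ih

lemma Bi.E {w N : ℤ} {f : Rinf} (h : Bi w N f) : Bi (w + 1) N (Einf f) := by
  induction h with
  | one => rw [Derivation.map_one_eq_zero]; exact Bi.zero _ _
  | zero w N => rw [map_zero]; exact Bi.zero _ _
  | mulx w N f n k hf ih =>
    rw [Derivation.leibniz, smul_eq_mul, smul_eq_mul]
    refine Bi.add _ _ _ _ ((Bi.mulx _ _ _ n k ih).cast (by ring) rfl) ?_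
    by_cases hk : 2 ≤ n ∧ k ≤ n
    · rw [E_xv n k hk, mul_comm, smul_mul_assoc]
      exact Bi.smul _ _ _ _ ((Bi.mulx _ _ _ n (k + 1) hf).cast (by push_cast; ring) rfl)
    · rw [xv_zero hk, map_zero, mul_zero]; exact Bi.zero _ _
  | add w N f g _ _ ih1 ih2 => rw [map_add]; exact Bi.add _ _ _ _ ih1 ih2
  | smul w N c f _ ih => rw [Derivation.map_smul]; exact Bi.smul _ _ _ _ ih

lemma Bi.H {w N : ℤ} {f : Rinf} (h : Bi w N f) : Hinf f = ((N : ℚ) - 2 * w) • f := by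
  induction h with
  | one => rw [Derivation.map_one_eq_zero]; simp
  | zero w N => rw [map_zero, smul_zero]
  | mulx w N f n k hf ih =>
    rw [Derivation.leibniz, smul_eq_mul, smul_eq_mul, ih, H_xv]
    rw [mul_smul_comm, mul_smul_comm, mul_comm f, ← add_smul]
    congr 1
    push_cast; ring
  | add w N f g _ _ ih1 ih2 => rw [map_add, ih1, ih2, smul_add]
  | smul w N c f _ ih => rw [Derivation.map_smul, ih, smul_comm]

lemma Dpow_add (m : ℕ) (f g : Rinf) : Dinf^[m] (f + g) = Dinf^[m] f + Dinf^[m] g := by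
  induction m generalizing f g with
  | zero => rfl
  | succ m ih => rw [Function.iterate_succ_apply, map_add, ih]; rfl

lemma Dpow_smul (m : ℕ) (c : ℚ) (f : Rinf) : Dinf^[m] (c • f) = c • Dinf^[m] f := by
  induction m generalizing f with
  | zero => rfl
  | succ m ih => rw [Function.iterate_succ_apply, Derivation.map_smul, ih]; rfl

lemma comm_pow (m : ℕ) (w N : ℤ) (f : Rinf) (h : Bi w N f) :
    Dinf^[m + 1] (Einf f) = Einf (Dinf^[m + 1] f)
      + (((m : ℚ) + 1) * ((N : ℚ) - 2 * w + m)) • Dinf^[m] f := by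
  induction m generalizing w f with
  | zero => simp [DE, h.H]
  | succ m ih =>
    rw [Function.iterate_succ_apply, DE, h.H, Dpow_add, Dpow_smul, ih _ _ h.D,
      ← Function.iterate_succ_apply, ← Function.iterate_succ_apply, add_assoc, ← add_smul]
    congr 2
    push_cast; ring

lemma sl2 (m : ℕ) (w N : ℤ) (hN : 1 ≤ N - 2 * w) (f : Rinf) (h : Bi w N f)
    (hm : Dinf^[m] f = 0) : ∃ g, Bi (w + 1) N g ∧ Dinf g = f := by
  induction m generalizing f with
  | zero => exact ⟨0, Bi.zero _ _, by rw [map_zero]; exact hm.symm⟩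
  | succ m ih =>
    set c : ℚ := ((m : ℚ) + 1) * ((N : ℚ) - 2 * w + m) with hc
    have hc0 : c ≠ 0 := by
      have : (1 : ℚ) ≤ (N : ℚ) - 2 * w := by exact_mod_cast hN
      positivity
    obtain ⟨g, hg, hDg⟩ := ih (Dinf (Einf f) + (-c) • f)
      (Bi.add _ _ _ _ (h.E.D.cast (by ring) rfl) (Bi.smul _ _ _ _ h)) (by
        rw [Dpow_add, Dpow_smul, ← Function.iterate_succ_apply, comm_pow m w N f h, hm, map_zero,
          ← hc]
        simp)
    refine ⟨c⁻¹ • (Einf f + (-1 : ℚ) • g),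
      Bi.smul _ _ _ _ (Bi.add _ _ _ _ h.E (Bi.smul _ _ _ _ hg)), ?_⟩
    rw [Derivation.map_smul, map_add, Derivation.map_smul, hDg]
    have : Dinf (Einf f) + (-1 : ℚ) • (Dinf (Einf f) + (-c) • f) = c • f := by
      module
    rw [this, smul_smul, inv_mul_cancel₀ hc0, one_smul]

lemma Bi.nil {w N : ℤ} {f : Rinf} (h : Bi w N f) (m : ℕ) : Bi (w - m) N (Dinf^[m] f) := by
  induction m generalizing w f with
  | zero => simpa using h
  | succ m ih =>
    rw [Function.iterate_succ_apply]
    exact (ih h.D).cast (by push_cast; ring) rfl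

lemma Bi.memIm {N : ℤ} {f : Rinf} (h : Bi 4 N f) (hN : 9 ≤ N) : f ∈ Im := by
  obtain ⟨g, hg, rfl⟩ := sl2 5 4 N (by omega) f h ((h.nil 5).neg (by norm_num))
  exact D_mem (hg.memW 5 (by norm_num))

lemma Bi.x (n k : ℕ) : Bi k n (xv n k) := by
  have := Bi.mulx 0 0 1 n k Bi.one
  rw [mul_one] at this
  exact this.cast (by ring) (by ring)

/-- The annihilator ideal of the class of `g`. -/
def J (g : Rinf) : Ideal SAlg where
  carrier := {a | (a : Rinf) * g ∈ Im}
  zero_mem' := by simp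
  add_mem' := by
    intro a b ha hb
    have := Submodule.add_mem Im ha hb
    rw [← add_mul] at this
    exact this
  smul_mem' := by
    intro c a ha
    have := Im_smul c ha
    rw [← mul_assoc] at this
    exact this

lemma J_one {g : Rinf} {N : ℤ} (hg : Bi 4 N g) {n : ℕ} (h : 9 ≤ N + n) : eS n ∈ J g := by
  change xv n 0 * g ∈ Im
  exact ((Bi.mulx _ _ _ n 0 hg).cast (by norm_num) rfl : Bi 4 _ _).memIm h

lemma J_two {g : Rinf} {N : ℤ} (hg : Bi 4 N g) {n m : ℕ} (h : 9 ≤ N + n + m) :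
    eS m * eS n ∈ J g := by
  change xv m 0 * xv n 0 * g ∈ Im
  rw [mul_assoc]
  exact ((Bi.mulx _ _ _ m 0 (Bi.mulx _ _ _ n 0 hg)).cast (by norm_num) rfl : Bi 4 _ _).memIm h

lemma I₁_le {g : Rinf} (hg : Bi 4 4 g) : I₁ ≤ J g := by
  refine Ideal.span_le.mpr ?_
  rintro a (rfl | ⟨α, β, h1, h2, h3, rfl⟩ | ⟨γ, h, rfl⟩)
  · rw [pow_succ]
    change xv 2 0 ^ 2 * xv 2 0 * g ∈ Im
    have := ((Bi.mulx _ _ _ 2 0 (Bi.mulx _ _ _ 2 0 (Bi.mulx _ _ _ 2 0 hg))).cast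
      (by norm_num) rfl : Bi 4 _ _).memIm (by norm_num)
    convert this using 1; ring
  · refine J_two hg ?_
    push_cast
    omega
  · refine J_one hg ?_
    push_cast
    omega

lemma I₂_le {g : Rinf} (hg : Bi 4 5 g) : I₂ ≤ J g := by
  refine Ideal.span_le.mpr ?_
  rintro a (⟨γ, h, rfl⟩ | ⟨α, β, h1, h2, rfl⟩)
  · refine J_one hg ?_
    push_cast
    omega
  · refine J_two hg ?_
    push_cast
    omega

lemma I₃_le {g : Rinf} (hg : Bi 4 6 g) : I₃ ≤ J g := by
  refine Ideal.span_le.mpr ?_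
  rintro a (⟨γ, h, rfl⟩ | ⟨α, β, h1, h2, rfl⟩)
  · refine J_one hg ?_
    push_cast
    omega
  · refine J_two hg ?_
    push_cast
    omega

lemma bi0 : Bi 4 4 (xv 4 4) := Bi.x 4 4
lemma bi1 : Bi 4 4 (xv 2 2 ^ 2) := by
  rw [sq]; exact (Bi.mulx _ _ _ 2 2 (Bi.x 2 2)).cast (by norm_num) (by norm_num)
lemma bi2 : Bi 4 5 (xv 3 3 * xv 2 1) :=
  (Bi.mulx _ _ _ 3 3 (Bi.x 2 1)).cast (by norm_num) (by norm_num)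
lemma bi3 : Bi 4 6 (xv 3 3 * xv 3 1) :=
  (Bi.mulx _ _ _ 3 3 (Bi.x 3 1)).cast (by norm_num) (by norm_num)

/-! ### The three relations -/

lemma Dm3 (a b c i j k : ℕ) (h : i + j + k = 5) : Dinf (xv a i * xv b j * xv c k) ∈ Im := by
  have := W_mul (W_mul (xv_mem a i) (xv_mem b j)) (xv_mem c k)
  rw [h] at this
  exact D_mem this

lemma rho1 : 2 * (xv 3 0 * (xv 3 3 * xv 2 1)) + 3 * (xv 2 0 * (xv 3 3 * xv 3 1)) ∈ Im := by
  have h1 := Dm3 3 3 2 2 3 0 rfl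
  have h2 := Dm3 3 3 2 1 3 1 rfl
  have h3 := Dm3 3 3 2 2 2 1 rfl
  have h := Submodule.sub_mem _ (Submodule.add_mem _ h1 (Submodule.add_mem _ h2 h2)) h3
  simp only [Derivation.leibniz, smul_eq_mul, D_xv0, D_xv (show 0 + 1 ≤ 2 by norm_num),
    D_xv (show 0 + 1 ≤ 3 by norm_num), D_xv (show 1 + 1 ≤ 3 by norm_num),
    D_xv (show 2 + 1 ≤ 3 by norm_num)] at h
  convert h using 1
  ring

lemma rho2 : xv 3 0 * xv 2 2 ^ 2 + 6 * (xv 2 0 * (xv 3 3 * xv 2 1)) ∈ Im := by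
  have h1 := Dm3 3 2 2 1 2 2 rfl
  have h2 := Dm3 3 2 2 2 1 2 rfl
  have h3 := Dm3 3 2 2 3 0 2 rfl
  have h4 := Dm3 3 2 2 3 1 1 rfl
  have h5 := Submodule.sub_mem _ (Submodule.add_mem _ h3 h4) h2
  have h := Submodule.add_mem _ h1 (Submodule.add_mem _ h5 h5)
  simp only [Derivation.leibniz, smul_eq_mul, D_xv0, D_xv (show 0 + 1 ≤ 2 by norm_num),
    D_xv (show 1 + 1 ≤ 2 by norm_num),
    D_xv (show 0 + 1 ≤ 3 by norm_num), D_xv (show 1 + 1 ≤ 3 by norm_num),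
    D_xv (show 2 + 1 ≤ 3 by norm_num)] at h
  convert h using 1
  ring

lemma rho3 : xv 4 0 * xv 2 2 ^ 2 - 6 * (xv 2 0 ^ 2 * xv 4 4) ∈ Im := by
  have h1 := Dm3 4 2 2 1 2 2 rfl
  have h2 := Dm3 4 2 2 2 1 2 rfl
  have h3 := Dm3 4 2 2 3 0 2 rfl
  have h4 := Dm3 4 2 2 3 1 1 rfl
  have h6 := Dm3 4 2 2 4 0 1 rfl
  have h5 := Submodule.sub_mem _ (Submodule.add_mem _ h3 h4) h2
  have h := Submodule.sub_mem _ (Submodule.add_mem _ h1 (Submodule.add_mem _ h5 h5))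
    (Submodule.smul_mem _ (6 : ℚ) h6)
  simp only [Derivation.leibniz, smul_eq_mul, D_xv0, D_xv (show 0 + 1 ≤ 2 by norm_num),
    D_xv (show 1 + 1 ≤ 2 by norm_num),
    D_xv (show 0 + 1 ≤ 4 by norm_num), D_xv (show 1 + 1 ≤ 4 by norm_num),
    D_xv (show 2 + 1 ≤ 4 by norm_num), D_xv (show 3 + 1 ≤ 4 by norm_num)] at h
  rw [smul_eq_C_mul, map_ofNat] at h
  convert h using 1
  ring

/-! ### The dual pairing -/

/-- The factorial of a multi-index. -/
def fac (m : Idx →₀ ℕ) : ℚ := m.prod fun _ k => (k.factorial : ℚ)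

lemma fac_succ (m : Idx →₀ ℕ) (s : Idx) :
    fac (m + Finsupp.single s 1) = ((m s : ℚ) + 1) * fac m := by
  unfold fac
  rw [← Finsupp.mul_prod_erase' (m + Finsupp.single s 1) s _ (by simp),
    ← Finsupp.mul_prod_erase' m s _ (by simp), Finsupp.erase_add, Finsupp.erase_single, add_zero,
    Finsupp.add_apply, Finsupp.single_eq_same, Nat.factorial_succ]
  push_cast; ring

/-- The pairing `⟨f, P⟩ = (f(∂) P)(0)`. -/
def B (P : Rinf) : Rinf →ₗ[ℚ] ℚ :=
  (basisMonomials Idx ℚ).constr ℚ fun m => coeff m P * fac m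

lemma B_monomial (P : Rinf) (m : Idx →₀ ℕ) : B P (monomial m 1) = coeff m P * fac m := by
  have := (basisMonomials Idx ℚ).constr_basis ℚ (fun m => coeff m P * fac m) m
  rwa [coe_basisMonomials] at this

lemma X_mul_mono (s : Idx) (m : Idx →₀ ℕ) :
    (X s * monomial m 1 : Rinf) = monomial (m + Finsupp.single s 1) 1 := by
  rw [X, monomial_mul, one_mul, add_comm]

lemma B_X (P : Rinf) (s : Idx) (f : Rinf) : B P (X s * f) = B (pderiv s P) f := by
  have : B P ∘ₗ LinearMap.mulLeft ℚ (X s) = B (pderiv s P) := by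
    refine (basisMonomials Idx ℚ).ext fun m => ?_
    rw [coe_basisMonomials]
    rw [LinearMap.comp_apply, LinearMap.mulLeft_apply]
    rw [X_mul_mono, B_monomial, B_monomial, coeff_pderiv, fac_succ]
    ring
  exact LinearMap.congr_fun this f

lemma B_one (P : Rinf) : B P 1 = constantCoeff P := by
  have := B_monomial P 0
  rw [show (monomial (0 : Idx →₀ ℕ) (1 : ℚ) : Rinf) = 1 from rfl] at this
  rw [this]
  simp [fac, constantCoeff_eq]

/-- The adjoint derivation. -/
def Dst : Derivation ℚ Rinf Rinf :=
  MvPolynomial.mkDerivation ℚ fun s : Idx => xv s.1.1 (s.1.2 + 1)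

lemma Dst_xv (n k : ℕ) : Dst (xv n k) = xv n (k + 1) := by
  by_cases h : 2 ≤ n ∧ k ≤ n
  · rw [xv_eq h, Dst, mkDerivation_X]
  · rw [xv_zero h, xv_zero (by omega), map_zero]

/-- Partial derivative by `x_{n,k}`. -/
def pd (n k : ℕ) : Derivation ℚ Rinf Rinf :=
  if h : 2 ≤ n ∧ k ≤ n then pderiv ⟨(n, k), h⟩ else 0

lemma pd_xv (n k a b : ℕ) :
    pd n k (xv a b) = if (2 ≤ a ∧ b ≤ a) ∧ n = a ∧ k = b then 1 else 0 := by
  classical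
  by_cases h : 2 ≤ n ∧ k ≤ n
  · rw [pd, dif_pos h]
    by_cases h' : 2 ≤ a ∧ b ≤ a
    · rw [xv_eq h', pderiv_X, Pi.single_apply]
      simp only [Subtype.mk.injEq, Prod.mk.injEq, h', true_and, and_self]
      congr 1
      exact propext ⟨fun h => ⟨h.1.symm, h.2.symm⟩, fun h => ⟨h.1.symm, h.2.symm⟩⟩
    · rw [xv_zero h', map_zero, if_neg (fun hc => h' hc.1)]
  · rw [pd, dif_neg h, if_neg]
    · rfl
    · rintro ⟨h1, rfl, rfl⟩; exact h h1

lemma B_mul (P : Rinf) (n k : ℕ) (f : Rinf) : B P (xv n k * f) = B (pd n k P) f := by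
  by_cases h : 2 ≤ n ∧ k ≤ n
  · rw [xv_eq h, B_X, pd, dif_pos h]
  · rw [xv_zero h, zero_mul, map_zero, pd, dif_neg h]
    have : B 0 = 0 := by
      refine (basisMonomials Idx ℚ).ext fun m => ?_
      rw [coe_basisMonomials]
      change B 0 (monomial m 1) = 0
      rw [B_monomial]; simp
    rw [show (0 : Derivation ℚ Rinf Rinf) P = 0 from rfl, this]; rfl

lemma B_x (P : Rinf) (n k : ℕ) : B P (xv n k) = constantCoeff (pd n k P) := by
  rw [← mul_one (xv n k), B_mul, B_one]

lemma B_add (P P' f : Rinf) : B (P + P') f = B P f + B P' f := by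
  have : B (P + P') = B P + B P' := by
    refine (basisMonomials Idx ℚ).ext fun m => ?_
    rw [coe_basisMonomials]
    change B (P + P') (monomial m 1) = B P (monomial m 1) + B P' (monomial m 1)
    rw [B_monomial, B_monomial, B_monomial, coeff_add]; ring
  rw [this]; rfl

lemma pd_Dst (n k : ℕ) (h : 2 ≤ n ∧ k ≤ n) (P : Rinf) :
    pd n k (Dst P) = Dst (pd n k P) + (if k = 0 then 0 else pd n (k - 1) P) := by
  have : ⁅pd n k, Dst⁆ = if k = 0 then 0 else pd n (k - 1) := by
    refine derivation_ext fun s => ?_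
    obtain ⟨⟨a, b⟩, hs⟩ := s
    rw [X_eq, Derivation.commutator_apply, Dst_xv, pd_xv, pd_xv]
    have h0 : Dst (if (2 ≤ a ∧ b ≤ a) ∧ n = a ∧ k = b then (1 : Rinf) else 0) = 0 := by
      split_ifs
      · exact Derivation.map_one_eq_zero _
      · exact map_zero _
    rw [h0, sub_zero]
    split_ifs with h1 h2 h2
    · exfalso; omega
    · rw [pd_xv, if_pos]
      dsimp only at *
      omega
    · rfl
    · rw [pd_xv, if_neg]
      dsimp only at *
      omega
  have h2 := congrArg (fun d : Derivation ℚ Rinf Rinf => d P) this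
  rw [Derivation.commutator_apply] at h2
  split_ifs at h2 ⊢ with hk
  · rw [← sub_eq_iff_eq_add', h2]; rfl
  · rw [← sub_eq_iff_eq_add', h2]

lemma cc_Dst (P : Rinf) : constantCoeff (Dst P) = 0 := by
  induction P using MvPolynomial.induction_on with
  | C a => rw [show (C a : Rinf) = algebraMap ℚ Rinf a from rfl, Derivation.map_algebraMap, map_zero]
  | add p q hp hq => rw [map_add, map_add, hp, hq, add_zero]
  | mul_X p s hp =>
    rw [Derivation.leibniz, map_add, smul_eq_mul, smul_eq_mul, map_mul, map_mul, hp, mul_zero,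
      add_zero, X_eq, Dst_xv]
    by_cases h : 2 ≤ s.1.1 ∧ s.1.2 + 1 ≤ s.1.1
    · rw [xv_eq h, constantCoeff_X, mul_zero]
    · rw [xv_zero h, map_zero, mul_zero]

lemma B_D (f P : Rinf) : B P (Dinf f) = B (Dst P) f := by
  induction f using MvPolynomial.induction_on generalizing P with
  | C a =>
    rw [show (C a : Rinf) = algebraMap ℚ Rinf a from rfl, Derivation.map_algebraMap, map_zero,
      Algebra.algebraMap_eq_smul_one, map_smul, B_one, cc_Dst, smul_zero]
  | add p q hp hq => rw [map_add, map_add, map_add, hp, hq]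
  | mul_X p s hp =>
    obtain ⟨⟨n, k⟩, h⟩ := s
    rw [Derivation.leibniz, map_add, smul_eq_mul, smul_eq_mul, X_eq, mul_comm p (xv _ _), B_mul,
      B_mul, hp, pd_Dst n k h, B_add, add_comm]
    congr 1
    rcases k with _ | k
    · rw [D_xv0, mul_zero, map_zero, if_pos rfl]
      have := B_add 0 0 p
      rw [add_zero] at this
      linarith
    · rw [D_xv h.2, mul_comm, B_mul]
      simp

lemma B_Im (P : Rinf) (hP : Dst P = 0) {f : Rinf} (hf : f ∈ Im) : B P f = 0 := by
  obtain ⟨g, _, rfl⟩ := hf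
  change B P (Dinf g) = 0
  rw [B_D, hP]
  have := B_add 0 0 g
  rw [add_zero] at this
  linarith

lemma cc_xv (n k : ℕ) : constantCoeff (xv n k) = 0 := by
  by_cases h : 2 ≤ n ∧ k ≤ n
  · rw [xv_eq h, constantCoeff_X]
  · rw [xv_zero h, map_zero]

lemma xv_over (n k : ℕ) (h : n < k) : xv n k = 0 := xv_zero (by omega)

/-! ### Normal forms modulo `I₁` -/

lemma mem_prod {α β : ℕ} (h1 : 2 ≤ α) (h2 : 2 ≤ β) (h : ¬ (α = 2 ∧ β = 2)) :
    eS α * eS β ∈ I₁ := by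
  refine Ideal.subset_span (Or.inr (Or.inl ⟨α - 1, β - 1, by omega, by omega, by omega, ?_⟩))
  rw [Nat.sub_add_cancel (by omega), Nat.sub_add_cancel (by omega)]

lemma mem_big {α : ℕ} (h1 : 5 ≤ α) : eS α ∈ I₁ := by
  refine Ideal.subset_span (Or.inr (Or.inr ⟨α - 1, by omega, ?_⟩))
  rw [Nat.sub_add_cancel (by omega)]

lemma mem_cube : eS 2 ^ 3 ∈ I₁ := Ideal.subset_span (Or.inl rfl)

lemma nf_aux (x : Rinf) (hx : x ∈ SAlg) : ∃ q0 q1 q2 q3 q4 : ℚ,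
    Ideal.Quotient.mk I₁ ⟨x, hx⟩ = Ideal.Quotient.mk I₁ (algebraMap ℚ SAlg q0
      + algebraMap ℚ SAlg q1 * eS 2 + algebraMap ℚ SAlg q2 * eS 2 ^ 2 +
      algebraMap ℚ SAlg q3 * eS 3 + algebraMap ℚ SAlg q4 * eS 4) := by
  induction hx using Algebra.adjoin_induction with
  | mem x hx =>
    obtain ⟨n, hn, rfl⟩ := hx
    have : n = 2 ∨ n = 3 ∨ n = 4 ∨ 5 ≤ n := by omega
    rcases this with rfl | rfl | rfl | h
    · exact ⟨0, 1, 0, 0, 0, by simp [eS]⟩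
    · exact ⟨0, 0, 0, 1, 0, by simp [eS]⟩
    · exact ⟨0, 0, 0, 0, 1, by simp [eS]⟩
    · refine ⟨0, 0, 0, 0, 0, ?_⟩
      simp only [map_zero, zero_mul, add_zero]
      exact Ideal.Quotient.eq_zero_iff_mem.mpr (mem_big h)
  | algebraMap r =>
    refine ⟨r, 0, 0, 0, 0, ?_⟩
    simp only [map_zero, zero_mul, add_zero]
    rfl
  | add x y hx hy ih1 ih2 =>
    obtain ⟨q0, q1, q2, q3, q4, h1⟩ := ih1
    obtain ⟨r0, r1, r2, r3, r4, h2⟩ := ih2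
    refine ⟨q0 + r0, q1 + r1, q2 + r2, q3 + r3, q4 + r4, ?_⟩
    rw [show (⟨x + y, _⟩ : SAlg) = ⟨x, hx⟩ + ⟨y, hy⟩ from rfl, map_add, h1, h2, ← map_add]
    congr 1
    simp only [map_add]; ring
  | mul x y hx hy ih1 ih2 =>
    obtain ⟨q0, q1, q2, q3, q4, h1⟩ := ih1
    obtain ⟨r0, r1, r2, r3, r4, h2⟩ := ih2
    refine ⟨q0 * r0, q0 * r1 + q1 * r0, q0 * r2 + q1 * r1 + q2 * r0, q0 * r3 + q3 * r0,
      q0 * r4 + q4 * r0, ?_⟩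
    rw [show (⟨x * y, _⟩ : SAlg) = ⟨x, hx⟩ * ⟨y, hy⟩ from rfl, map_mul, h1, h2]
    have c1 := Ideal.Quotient.eq_zero_iff_mem.mpr mem_cube
    have c2 := Ideal.Quotient.eq_zero_iff_mem.mpr
      (mem_prod (α := 2) (β := 3) (by norm_num) (by norm_num) (by norm_num))
    have c3 := Ideal.Quotient.eq_zero_iff_mem.mpr
      (mem_prod (α := 2) (β := 4) (by norm_num) (by norm_num) (by norm_num))
    have c4 := Ideal.Quotient.eq_zero_iff_mem.mpr
      (mem_prod (α := 3) (β := 3) (by norm_num) (by norm_num) (by norm_num))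
    have c5 := Ideal.Quotient.eq_zero_iff_mem.mpr
      (mem_prod (α := 3) (β := 4) (by norm_num) (by norm_num) (by norm_num))
    have c6 := Ideal.Quotient.eq_zero_iff_mem.mpr
      (mem_prod (α := 4) (β := 4) (by norm_num) (by norm_num) (by norm_num))
    simp only [map_add, map_mul, map_pow] at c1 c2 c3 c4 c5 c6 ⊢
    generalize Ideal.Quotient.mk I₁ (eS 2) = e at *
    generalize Ideal.Quotient.mk I₁ (eS 3) = f at *
    generalize Ideal.Quotient.mk I₁ (eS 4) = g at *
    generalize Ideal.Quotient.mk I₁ (algebraMap ℚ SAlg q0) = q0 at *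
    generalize Ideal.Quotient.mk I₁ (algebraMap ℚ SAlg q1) = q1 at *
    generalize Ideal.Quotient.mk I₁ (algebraMap ℚ SAlg q2) = q2 at *
    generalize Ideal.Quotient.mk I₁ (algebraMap ℚ SAlg q3) = q3 at *
    generalize Ideal.Quotient.mk I₁ (algebraMap ℚ SAlg q4) = q4 at *
    generalize Ideal.Quotient.mk I₁ (algebraMap ℚ SAlg r0) = r0 at *
    generalize Ideal.Quotient.mk I₁ (algebraMap ℚ SAlg r1) = r1 at *
    generalize Ideal.Quotient.mk I₁ (algebraMap ℚ SAlg r2) = r2 at *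
    generalize Ideal.Quotient.mk I₁ (algebraMap ℚ SAlg r3) = r3 at *
    generalize Ideal.Quotient.mk I₁ (algebraMap ℚ SAlg r4) = r4 at *
    linear_combination (q1 * r2 + q2 * r1 + q2 * r2 * e) * c1
      + (q1 * r3 + q3 * r1 + (q2 * r3 + q3 * r2) * e) * c2
      + (q1 * r4 + q4 * r1 + (q2 * r4 + q4 * r2) * e) * c3
      + q3 * r3 * c4 + (q3 * r4 + q4 * r3) * c5 + q4 * r4 * c6

lemma nf (s : SAlg) : ∃ (q0 q1 q2 q3 q4 : ℚ) (a : SAlg), a ∈ I₁ ∧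
    s = q0 • (1 : SAlg) + q1 • eS 2 + q2 • eS 2 ^ 2 + q3 • eS 3 + q4 • eS 4 + a := by
  obtain ⟨q0, q1, q2, q3, q4, h⟩ := nf_aux s s.2
  refine ⟨q0, q1, q2, q3, q4, _, Ideal.Quotient.eq.mp h, ?_⟩
  simp only [Algebra.smul_def, mul_one]
  ring

lemma I₁_le_I₂ : I₁ ≤ I₂ := by
  refine Ideal.span_le.mpr ?_
  rintro a (rfl | ⟨α, β, h1, h2, h3, rfl⟩ | ⟨γ, h, rfl⟩)
  · rw [pow_succ, sq]
    exact Ideal.mul_mem_right _ _ (Ideal.subset_span (Or.inr ⟨1, 1, le_rfl, le_rfl, rfl⟩))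
  · exact Ideal.subset_span (Or.inr ⟨α, β, h1, h2, rfl⟩)
  · exact Ideal.subset_span (Or.inl ⟨γ, by omega, rfl⟩)

lemma I₂_le_I₃ : I₂ ≤ I₃ := by
  refine Ideal.span_le.mpr ?_
  rintro a (⟨γ, h, rfl⟩ | ⟨α, β, h1, h2, rfl⟩)
  · exact Ideal.subset_span (Or.inl ⟨γ, by omega, rfl⟩)
  · exact Ideal.subset_span (Or.inr ⟨α, β, h1, h2, rfl⟩)

lemma sq_mem_I₂ : eS 2 ^ 2 ∈ I₂ := by
  rw [sq]; exact Ideal.subset_span (Or.inr ⟨1, 1, le_rfl, le_rfl, rfl⟩)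

lemma e4_mem_I₂ : eS 4 ∈ I₂ := Ideal.subset_span (Or.inl ⟨3, le_rfl, rfl⟩)

lemma e3_mem_I₃ : eS 3 ∈ I₃ := Ideal.subset_span (Or.inl ⟨2, le_rfl, rfl⟩)

/-! ### The twelve functionals -/


/-- The general combination of the reduced generators. -/
def FF (p0 p1 p2 p3 p4 q0 q1 q2 q3 q4 r0 r1 r3 t0 t1 : ℚ) : Rinf :=
    p0 • (xv 4 4) +
    p1 • (xv 2 0 * xv 4 4) +
    p2 • (xv 2 0 * (xv 2 0 * xv 4 4)) +
    p3 • (xv 3 0 * xv 4 4) +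
    p4 • (xv 4 0 * xv 4 4) +
    q0 • (xv 2 2 * xv 2 2) +
    q1 • (xv 2 0 * (xv 2 2 * xv 2 2)) +
    q2 • (xv 2 0 * (xv 2 0 * (xv 2 2 * xv 2 2))) +
    q3 • (xv 3 0 * (xv 2 2 * xv 2 2)) +
    q4 • (xv 4 0 * (xv 2 2 * xv 2 2)) +
    r0 • (xv 3 3 * xv 2 1) +
    r1 • (xv 2 0 * (xv 3 3 * xv 2 1)) +
    r3 • (xv 3 0 * (xv 3 3 * xv 2 1)) +
    t0 • (xv 3 3 * xv 3 1) +
    t1 • (xv 2 0 * (xv 3 3 * xv 3 1))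

lemma B_FF (P : Rinf) (p0 p1 p2 p3 p4 q0 q1 q2 q3 q4 r0 r1 r3 t0 t1 : ℚ) :
    B P (FF p0 p1 p2 p3 p4 q0 q1 q2 q3 q4 r0 r1 r3 t0 t1) =
    p0 * constantCoeff (pd 4 4 P) +
    p1 * constantCoeff (pd 4 4 (pd 2 0 P)) +
    p2 * constantCoeff (pd 4 4 (pd 2 0 (pd 2 0 P))) +
    p3 * constantCoeff (pd 4 4 (pd 3 0 P)) +
    p4 * constantCoeff (pd 4 4 (pd 4 0 P)) +
    q0 * constantCoeff (pd 2 2 (pd 2 2 P)) +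
    q1 * constantCoeff (pd 2 2 (pd 2 2 (pd 2 0 P))) +
    q2 * constantCoeff (pd 2 2 (pd 2 2 (pd 2 0 (pd 2 0 P)))) +
    q3 * constantCoeff (pd 2 2 (pd 2 2 (pd 3 0 P))) +
    q4 * constantCoeff (pd 2 2 (pd 2 2 (pd 4 0 P))) +
    r0 * constantCoeff (pd 2 1 (pd 3 3 P)) +
    r1 * constantCoeff (pd 2 1 (pd 3 3 (pd 2 0 P))) +
    r3 * constantCoeff (pd 2 1 (pd 3 3 (pd 3 0 P))) +
    t0 * constantCoeff (pd 3 1 (pd 3 3 P)) +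
    t1 * constantCoeff (pd 3 1 (pd 3 3 (pd 2 0 P))) := by
  simp only [FF, map_add, map_smul, B_mul, B_x, smul_eq_mul]

/-- A highest weight vector. -/
def P4 : Rinf :=
  (1 : ℚ) • (xv 4 4)

lemma P4_Dst : Dst P4 = 0 := by
  simp only [P4, map_add, Derivation.map_smul, Derivation.leibniz, Dst_xv, smul_eq_mul,
    Nat.reduceAdd, xv_over 2 3 (by norm_num), xv_over 3 4 (by norm_num), xv_over 4 5 (by norm_num),
    mul_zero, zero_mul, add_zero, zero_add, smul_zero]
  try (simp only [smul_eq_C_mul, map_neg, map_ofNat, map_one]; ring)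

lemma P4_res (p0 p1 p2 p3 p4 q0 q1 q2 q3 q4 r0 r1 r3 t0 t1 : ℚ)
    (h : FF p0 p1 p2 p3 p4 q0 q1 q2 q3 q4 r0 r1 r3 t0 t1 ∈ Im) : p0 = 0 := by
  have := B_Im P4 P4_Dst h
  rw [B_FF] at this
  simp [P4, pd_xv, cc_xv] at this
  linarith

/-- A highest weight vector. -/
def P22 : Rinf :=
  (1 : ℚ) • (xv 2 2 * xv 2 2)

lemma P22_Dst : Dst P22 = 0 := by
  simp only [P22, map_add, Derivation.map_smul, Derivation.leibniz, Dst_xv, smul_eq_mul,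
    Nat.reduceAdd, xv_over 2 3 (by norm_num), xv_over 3 4 (by norm_num), xv_over 4 5 (by norm_num),
    mul_zero, zero_mul, add_zero, zero_add, smul_zero]
  try (simp only [smul_eq_C_mul, map_neg, map_ofNat, map_one]; ring)

lemma P22_res (p0 p1 p2 p3 p4 q0 q1 q2 q3 q4 r0 r1 r3 t0 t1 : ℚ)
    (h : FF p0 p1 p2 p3 p4 q0 q1 q2 q3 q4 r0 r1 r3 t0 t1 ∈ Im) : q0 = 0 := by
  have := B_Im P22 P22_Dst h
  rw [B_FF] at this
  simp [P22, pd_xv, cc_xv] at this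
  linarith

/-- A highest weight vector. -/
def P32 : Rinf :=
  (1 : ℚ) • (xv 3 3 * xv 2 1) + (-1 : ℚ) • (xv 3 2 * xv 2 2)

lemma P32_Dst : Dst P32 = 0 := by
  simp only [P32, map_add, Derivation.map_smul, Derivation.leibniz, Dst_xv, smul_eq_mul,
    Nat.reduceAdd, xv_over 2 3 (by norm_num), xv_over 3 4 (by norm_num), xv_over 4 5 (by norm_num),
    mul_zero, zero_mul, add_zero, zero_add, smul_zero]
  try (simp only [smul_eq_C_mul, map_neg, map_ofNat, map_one]; ring)

lemma P32_res (p0 p1 p2 p3 p4 q0 q1 q2 q3 q4 r0 r1 r3 t0 t1 : ℚ)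
    (h : FF p0 p1 p2 p3 p4 q0 q1 q2 q3 q4 r0 r1 r3 t0 t1 ∈ Im) : r0 = 0 := by
  have := B_Im P32 P32_Dst h
  rw [B_FF] at this
  simp [P32, pd_xv, cc_xv] at this
  linarith

/-- A highest weight vector. -/
def P42 : Rinf :=
  (1 : ℚ) • (xv 4 4 * xv 2 0) + (-1 : ℚ) • (xv 4 3 * xv 2 1) + (1 : ℚ) • (xv 4 2 * xv 2 2)

lemma P42_Dst : Dst P42 = 0 := by
  simp only [P42, map_add, Derivation.map_smul, Derivation.leibniz, Dst_xv, smul_eq_mul,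
    Nat.reduceAdd, xv_over 2 3 (by norm_num), xv_over 3 4 (by norm_num), xv_over 4 5 (by norm_num),
    mul_zero, zero_mul, add_zero, zero_add, smul_zero]
  try (simp only [smul_eq_C_mul, map_neg, map_ofNat, map_one]; ring)

lemma P42_res (p0 p1 p2 p3 p4 q0 q1 q2 q3 q4 r0 r1 r3 t0 t1 : ℚ)
    (h : FF p0 p1 p2 p3 p4 q0 q1 q2 q3 q4 r0 r1 r3 t0 t1 ∈ Im) : p1 = 0 := by
  have := B_Im P42 P42_Dst h
  rw [B_FF] at this
  simp [P42, pd_xv, cc_xv] at this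
  linarith

/-- A highest weight vector. -/
def P33 : Rinf :=
  (2 : ℚ) • (xv 3 3 * xv 3 1) + (-1 : ℚ) • (xv 3 2 * xv 3 2)

lemma P33_Dst : Dst P33 = 0 := by
  simp only [P33, map_add, Derivation.map_smul, Derivation.leibniz, Dst_xv, smul_eq_mul,
    Nat.reduceAdd, xv_over 2 3 (by norm_num), xv_over 3 4 (by norm_num), xv_over 4 5 (by norm_num),
    mul_zero, zero_mul, add_zero, zero_add, smul_zero]
  try (simp only [smul_eq_C_mul, map_neg, map_ofNat, map_one]; ring)

lemma P33_res (p0 p1 p2 p3 p4 q0 q1 q2 q3 q4 r0 r1 r3 t0 t1 : ℚ)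
    (h : FF p0 p1 p2 p3 p4 q0 q1 q2 q3 q4 r0 r1 r3 t0 t1 ∈ Im) : t0 = 0 := by
  have := B_Im P33 P33_Dst h
  rw [B_FF] at this
  simp [P33, pd_xv, cc_xv] at this
  linarith

/-- A highest weight vector. -/
def P222 : Rinf :=
  (2 : ℚ) • (xv 2 2 * xv 2 2 * xv 2 0) + (-1 : ℚ) • (xv 2 2 * xv 2 1 * xv 2 1)

lemma P222_Dst : Dst P222 = 0 := by
  simp only [P222, map_add, Derivation.map_smul, Derivation.leibniz, Dst_xv, smul_eq_mul,
    Nat.reduceAdd, xv_over 2 3 (by norm_num), xv_over 3 4 (by norm_num), xv_over 4 5 (by norm_num),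
    mul_zero, zero_mul, add_zero, zero_add, smul_zero]
  try (simp only [smul_eq_C_mul, map_neg, map_ofNat, map_one]; ring)

lemma P222_res (p0 p1 p2 p3 p4 q0 q1 q2 q3 q4 r0 r1 r3 t0 t1 : ℚ)
    (h : FF p0 p1 p2 p3 p4 q0 q1 q2 q3 q4 r0 r1 r3 t0 t1 ∈ Im) : q1 = 0 := by
  have := B_Im P222 P222_Dst h
  rw [B_FF] at this
  simp [P222, pd_xv, cc_xv] at this
  linarith

/-- A highest weight vector. -/
def P43 : Rinf :=
  (1 : ℚ) • (xv 4 4 * xv 3 0) + (-1 : ℚ) • (xv 4 3 * xv 3 1) + (1 : ℚ) • (xv 4 2 * xv 3 2) + (-1 : ℚ) • (xv 4 1 * xv 3 3)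

lemma P43_Dst : Dst P43 = 0 := by
  simp only [P43, map_add, Derivation.map_smul, Derivation.leibniz, Dst_xv, smul_eq_mul,
    Nat.reduceAdd, xv_over 2 3 (by norm_num), xv_over 3 4 (by norm_num), xv_over 4 5 (by norm_num),
    mul_zero, zero_mul, add_zero, zero_add, smul_zero]
  try (simp only [smul_eq_C_mul, map_neg, map_ofNat, map_one]; ring)

lemma P43_res (p0 p1 p2 p3 p4 q0 q1 q2 q3 q4 r0 r1 r3 t0 t1 : ℚ)
    (h : FF p0 p1 p2 p3 p4 q0 q1 q2 q3 q4 r0 r1 r3 t0 t1 ∈ Im) : p3 = 0 := by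
  have := B_Im P43 P43_Dst h
  rw [B_FF] at this
  simp [P43, pd_xv, cc_xv] at this
  linarith

/-- A highest weight vector. -/
def P322 : Rinf :=
  (-3 : ℚ) • (xv 3 0 * xv 2 2 * xv 2 2) + (3 : ℚ) • (xv 3 1 * xv 2 1 * xv 2 2) + (-1 : ℚ) • (xv 3 2 * xv 2 0 * xv 2 2) + (-1 : ℚ) • (xv 3 2 * xv 2 1 * xv 2 1) + (1 : ℚ) • (xv 3 3 * xv 2 0 * xv 2 1)

lemma P322_Dst : Dst P322 = 0 := by
  simp only [P322, map_add, Derivation.map_smul, Derivation.leibniz, Dst_xv, smul_eq_mul,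
    Nat.reduceAdd, xv_over 2 3 (by norm_num), xv_over 3 4 (by norm_num), xv_over 4 5 (by norm_num),
    mul_zero, zero_mul, add_zero, zero_add, smul_zero]
  try (simp only [smul_eq_C_mul, map_neg, map_ofNat, map_one]; ring)

lemma P322_res (p0 p1 p2 p3 p4 q0 q1 q2 q3 q4 r0 r1 r3 t0 t1 : ℚ)
    (h : FF p0 p1 p2 p3 p4 q0 q1 q2 q3 q4 r0 r1 r3 t0 t1 ∈ Im) : r1 = 6 * q3 := by
  have := B_Im P322 P322_Dst h
  rw [B_FF] at this
  simp [P322, pd_xv, cc_xv] at this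
  linarith

/-- A highest weight vector. -/
def P44 : Rinf :=
  (2 : ℚ) • (xv 4 0 * xv 4 4) + (-2 : ℚ) • (xv 4 1 * xv 4 3) + (1 : ℚ) • (xv 4 2 * xv 4 2)

lemma P44_Dst : Dst P44 = 0 := by
  simp only [P44, map_add, Derivation.map_smul, Derivation.leibniz, Dst_xv, smul_eq_mul,
    Nat.reduceAdd, xv_over 2 3 (by norm_num), xv_over 3 4 (by norm_num), xv_over 4 5 (by norm_num),
    mul_zero, zero_mul, add_zero, zero_add, smul_zero]
  try (simp only [smul_eq_C_mul, map_neg, map_ofNat, map_one]; ring)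

lemma P44_res (p0 p1 p2 p3 p4 q0 q1 q2 q3 q4 r0 r1 r3 t0 t1 : ℚ)
    (h : FF p0 p1 p2 p3 p4 q0 q1 q2 q3 q4 r0 r1 r3 t0 t1 ∈ Im) : p4 = 0 := by
  have := B_Im P44 P44_Dst h
  rw [B_FF] at this
  simp [P44, pd_xv, cc_xv] at this
  linarith

/-- A highest weight vector. -/
def P422 : Rinf :=
  (6 : ℚ) • (xv 4 0 * xv 2 2 * xv 2 2) + (-6 : ℚ) • (xv 4 1 * xv 2 1 * xv 2 2) + (2 : ℚ) • (xv 4 2 * xv 2 0 * xv 2 2) + (2 : ℚ) • (xv 4 2 * xv 2 1 * xv 2 1) + (-2 : ℚ) • (xv 4 3 * xv 2 0 * xv 2 1) + (1 : ℚ) • (xv 4 4 * xv 2 0 * xv 2 0)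

lemma P422_Dst : Dst P422 = 0 := by
  simp only [P422, map_add, Derivation.map_smul, Derivation.leibniz, Dst_xv, smul_eq_mul,
    Nat.reduceAdd, xv_over 2 3 (by norm_num), xv_over 3 4 (by norm_num), xv_over 4 5 (by norm_num),
    mul_zero, zero_mul, add_zero, zero_add, smul_zero]
  try (simp only [smul_eq_C_mul, map_neg, map_ofNat, map_one]; ring)

lemma P422_res (p0 p1 p2 p3 p4 q0 q1 q2 q3 q4 r0 r1 r3 t0 t1 : ℚ)
    (h : FF p0 p1 p2 p3 p4 q0 q1 q2 q3 q4 r0 r1 r3 t0 t1 ∈ Im) : p2 = -6 * q4 := by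
  have := B_Im P422 P422_Dst h
  rw [B_FF] at this
  simp [P422, pd_xv, cc_xv] at this
  linarith

/-- A highest weight vector. -/
def P332 : Rinf :=
  (-2 : ℚ) • (xv 3 1 * xv 3 3 * xv 2 0) + (1 : ℚ) • (xv 3 2 * xv 3 2 * xv 2 0) + (3 : ℚ) • (xv 3 0 * xv 3 3 * xv 2 1) + (-1 : ℚ) • (xv 3 1 * xv 3 2 * xv 2 1) + (-3 : ℚ) • (xv 3 0 * xv 3 2 * xv 2 2) + (2 : ℚ) • (xv 3 1 * xv 3 1 * xv 2 2)

lemma P332_Dst : Dst P332 = 0 := by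
  simp only [P332, map_add, Derivation.map_smul, Derivation.leibniz, Dst_xv, smul_eq_mul,
    Nat.reduceAdd, xv_over 2 3 (by norm_num), xv_over 3 4 (by norm_num), xv_over 4 5 (by norm_num),
    mul_zero, zero_mul, add_zero, zero_add, smul_zero]
  try (simp only [smul_eq_C_mul, map_neg, map_ofNat, map_one]; ring)

lemma P332_res (p0 p1 p2 p3 p4 q0 q1 q2 q3 q4 r0 r1 r3 t0 t1 : ℚ)
    (h : FF p0 p1 p2 p3 p4 q0 q1 q2 q3 q4 r0 r1 r3 t0 t1 ∈ Im) : 3 * r3 = 2 * t1 := by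
  have := B_Im P332 P332_Dst h
  rw [B_FF] at this
  simp [P332, pd_xv, cc_xv] at this
  linarith

/-- A highest weight vector. -/
def P2222 : Rinf :=
  (4 : ℚ) • (xv 2 0 * xv 2 0 * xv 2 2 * xv 2 2) + (-4 : ℚ) • (xv 2 0 * xv 2 2 * xv 2 1 * xv 2 1) + (1 : ℚ) • (xv 2 1 * xv 2 1 * xv 2 1 * xv 2 1)

lemma P2222_Dst : Dst P2222 = 0 := by
  simp only [P2222, map_add, Derivation.map_smul, Derivation.leibniz, Dst_xv, smul_eq_mul,
    Nat.reduceAdd, xv_over 2 3 (by norm_num), xv_over 3 4 (by norm_num), xv_over 4 5 (by norm_num),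
    mul_zero, zero_mul, add_zero, zero_add, smul_zero]
  try (simp only [smul_eq_C_mul, map_neg, map_ofNat, map_one]; ring)

lemma P2222_res (p0 p1 p2 p3 p4 q0 q1 q2 q3 q4 r0 r1 r3 t0 t1 : ℚ)
    (h : FF p0 p1 p2 p3 p4 q0 q1 q2 q3 q4 r0 r1 r3 t0 t1 ∈ Im) : q2 = 0 := by
  have := B_Im P2222 P2222_Dst h
  rw [B_FF] at this
  simp [P2222, pd_xv, cc_xv] at this
  linarith

/-- There is an `S`-module isomorphism `R_∞^{(4)}/D_∞(R_∞^{(5)}) ≅ 𝔏/𝔎` sending the classes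
of `x_{4,4}, x_{2,2}², x_{3,3}x_{2,1}, x_{3,3}x_{3,1}` to `u₁, u₂, u₃, u₄`: concretely, the
`S`-module map `S⁴ → R_∞^{(4)}/D_∞(R_∞^{(5)})`, `(s₁,…,s₄) ↦ [Σ sᵢ·gᵢ]`, is surjective, and
its kernel is `I₁×I₁×I₂×I₃` plus the `ℚ`-span of the lifts of
`ρ₁ = 2e₂u₃ + 3e₁u₄`, `ρ₂ = e₂u₂ + 6e₁u₃`, `ρ₃ = e₃u₂ − 6e₁²u₁` (the computation of
`H_st^even(Λ⁵H̃_ℚ) ≅ 𝔏/𝔎`). -/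
theorem statement15 :
    (∀ f ∈ W 4, ∃ s : Fin 4 → SAlg,
        f - ∑ i, (s i : Rinf) * gen5 i ∈ Submodule.map Dinf.toLinearMap (W 5)) ∧
    (∀ s : Fin 4 → SAlg,
        ((∑ i, (s i : Rinf) * gen5 i) ∈ Submodule.map Dinf.toLinearMap (W 5)) ↔
          ∃ (a₁ a₂ a₃ a₄ : SAlg) (c₁ c₂ c₃ : ℚ),
            a₁ ∈ I₁ ∧ a₂ ∈ I₁ ∧ a₃ ∈ I₂ ∧ a₄ ∈ I₃ ∧
            s 0 = a₁ - (6 * c₃) • (eS 2) ^ 2 ∧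
            s 1 = a₂ + c₂ • eS 3 + c₃ • eS 4 ∧
            s 2 = a₃ + (2 * c₁) • eS 3 + (6 * c₂) • eS 2 ∧
            s 3 = a₄ + (3 * c₁) • eS 2) := by
  constructor
  · intro f hf
    exact W_le_Q hf
  intro s
  have hsum : ∑ i, (s i : Rinf) * gen5 i = (s 0 : Rinf) * xv 4 4 + (s 1 : Rinf) * xv 2 2 ^ 2
      + (s 2 : Rinf) * (xv 3 3 * xv 2 1) + (s 3 : Rinf) * (xv 3 3 * xv 3 1) := by
    simp [Fin.sum_univ_four, gen5]
  rw [hsum]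
  change _ ∈ Im ↔ _
  constructor
  · intro h
    obtain ⟨p0, p1, p2, p3, p4, a₁, ha₁, e0⟩ := nf (s 0)
    obtain ⟨q0, q1, q2, q3, q4, a₂, ha₂, e1⟩ := nf (s 1)
    obtain ⟨r0, r1, r2, r3, r4, b₃, hb₃, e2⟩ := nf (s 2)
    obtain ⟨t0, t1, t2, t3, t4, b₄, hb₄, e3⟩ := nf (s 3)
    obtain ⟨a₃, ha₃, e2'⟩ : ∃ a₃ ∈ I₂, s 2 = r0 • (1 : SAlg) + r1 • eS 2 + r3 • eS 3 + a₃ := by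
      refine ⟨r2 • eS 2 ^ 2 + r4 • eS 4 + b₃, ?_, ?_⟩
      · exact Ideal.add_mem _ (Ideal.add_mem _ (Submodule.smul_of_tower_mem _ _ sq_mem_I₂)
          (Submodule.smul_of_tower_mem _ _ e4_mem_I₂)) (I₁_le_I₂ hb₃)
      · rw [e2]; abel
    obtain ⟨a₄, ha₄, e3'⟩ : ∃ a₄ ∈ I₃, s 3 = t0 • (1 : SAlg) + t1 • eS 2 + a₄ := by
      refine ⟨t2 • eS 2 ^ 2 + t3 • eS 3 + t4 • eS 4 + b₄, ?_, ?_⟩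
      · exact Ideal.add_mem _ (Ideal.add_mem _ (Ideal.add_mem _
          (Submodule.smul_of_tower_mem _ _ (I₂_le_I₃ sq_mem_I₂))
          (Submodule.smul_of_tower_mem _ _ e3_mem_I₃))
          (Submodule.smul_of_tower_mem _ _ (I₂_le_I₃ e4_mem_I₂))) (I₂_le_I₃ (I₁_le_I₂ hb₄))
      · rw [e3]; abel
    have k1 : (a₁ : Rinf) * xv 4 4 ∈ Im := I₁_le bi0 ha₁
    have k2 : (a₂ : Rinf) * xv 2 2 ^ 2 ∈ Im := I₁_le bi1 ha₂
    have k3 : (a₃ : Rinf) * (xv 3 3 * xv 2 1) ∈ Im := I₂_le bi2 ha₃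
    have k4 : (a₄ : Rinf) * (xv 3 3 * xv 3 1) ∈ Im := I₃_le bi3 ha₄
    have hF : FF p0 p1 p2 p3 p4 q0 q1 q2 q3 q4 r0 r1 r3 t0 t1 ∈ Im := by
      have := Submodule.sub_mem _ (Submodule.sub_mem _ (Submodule.sub_mem _
        (Submodule.sub_mem _ h k1) k2) k3) k4
      convert this using 1
      rw [e0, e1, e2', e3']
      simp only [FF, Subalgebra.coe_add, Subalgebra.coe_smul, Subalgebra.coe_pow,
        Subalgebra.coe_one, eS, smul_eq_C_mul]
      ring
    have z_P4 := P4_res _ _ _ _ _ _ _ _ _ _ _ _ _ _ _ hF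
    have z_P22 := P22_res _ _ _ _ _ _ _ _ _ _ _ _ _ _ _ hF
    have z_P32 := P32_res _ _ _ _ _ _ _ _ _ _ _ _ _ _ _ hF
    have z_P42 := P42_res _ _ _ _ _ _ _ _ _ _ _ _ _ _ _ hF
    have z_P33 := P33_res _ _ _ _ _ _ _ _ _ _ _ _ _ _ _ hF
    have z_P222 := P222_res _ _ _ _ _ _ _ _ _ _ _ _ _ _ _ hF
    have z_P43 := P43_res _ _ _ _ _ _ _ _ _ _ _ _ _ _ _ hF
    have z_P322 := P322_res _ _ _ _ _ _ _ _ _ _ _ _ _ _ _ hF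
    have z_P44 := P44_res _ _ _ _ _ _ _ _ _ _ _ _ _ _ _ hF
    have z_P422 := P422_res _ _ _ _ _ _ _ _ _ _ _ _ _ _ _ hF
    have z_P332 := P332_res _ _ _ _ _ _ _ _ _ _ _ _ _ _ _ hF
    have z_P2222 := P2222_res _ _ _ _ _ _ _ _ _ _ _ _ _ _ _ hF
    refine ⟨a₁, a₂, a₃, a₄, t1 / 3, q3, q4, ha₁, ha₂, ha₃, ha₄, ?_, ?_, ?_, ?_⟩
    · rw [e0, z_P4, z_P42, z_P43, z_P44, z_P422]; module
    · rw [e1, z_P22, z_P222, z_P2222]; module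
    · have z : 2 * (t1 / 3) = r3 := by linarith
      rw [e2', z_P32, z_P322, z]; module
    · have z : 3 * (t1 / 3) = t1 := by ring
      rw [e3', z_P33, z]; module
  · rintro ⟨a₁, a₂, a₃, a₄, c₁, c₂, c₃, ha₁, ha₂, ha₃, ha₄, e0, e1, e2, e3⟩
    have k1 : (a₁ : Rinf) * xv 4 4 ∈ Im := I₁_le bi0 ha₁
    have k2 : (a₂ : Rinf) * xv 2 2 ^ 2 ∈ Im := I₁_le bi1 ha₂
    have k3 : (a₃ : Rinf) * (xv 3 3 * xv 2 1) ∈ Im := I₂_le bi2 ha₃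
    have k4 : (a₄ : Rinf) * (xv 3 3 * xv 3 1) ∈ Im := I₃_le bi3 ha₄
    have := Submodule.add_mem _ (Submodule.add_mem _ (Submodule.add_mem _ (Submodule.add_mem _
      (Submodule.add_mem _ (Submodule.add_mem _ k1 k2) k3) k4)
      (Submodule.smul_mem _ c₁ rho1)) (Submodule.smul_mem _ c₂ rho2)) (Submodule.smul_mem _ c₃ rho3)
    convert this using 1
    rw [e0, e1, e2, e3]
    simp only [Subalgebra.coe_add, Subalgebra.coe_sub, Subalgebra.coe_smul, Subalgebra.coe_pow,
      eS, smul_eq_C_mul, C_mul, map_ofNat]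
    ring

end
end

section
/- Let M := A/(e₁³, e₂², e₃², e₁e₂, e₁e₃, e₂e₃). Then the ℚ-vector space H_j(A; M) = Tor_j^A(ℚ, M) has dimension 1 for j = 0, dimension 6 for j = 1, dimension 8 for j = 2, dimension 3 for j = 3, and is zero for j ≥ 4. -/
open CategoryTheory MvPolynomial

noncomputable section

/-- `A = ℚ[e₁, e₂, e₃]`, the polynomial ring in three variables over `ℚ`;
the variable `eᵢ` is `X (i-1) : A` for `i = 1, 2, 3`. -/
abbrev A : Type := MvPolynomial (Fin 3) ℚ

/-- `ℚ` as an `A`-module via the augmentation sending each variable to `0`. -/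
instance : Module A ℚ :=
  Module.compHom ℚ (MvPolynomial.aeval (fun _ : Fin 3 => (0 : ℚ))).toRingHom

/-- `H_j(A; M) = Tor_j^A(ℚ, M)`, as a `ℚ`-vector space (via restriction of scalars along
`ℚ → A`). -/
def TorQ (j : ℕ) (M : ModuleCat A) : ModuleCat ℚ :=
  (ModuleCat.restrictScalars (algebraMap ℚ A)).obj
    (((Tor (ModuleCat A) j).obj (ModuleCat.of A ℚ)).obj M)

/-- The `A`-module `M = A/(e₁³, e₂², e₃², e₁e₂, e₁e₃, e₂e₃)`. -/
def M18 : ModuleCat A :=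
  ModuleCat.of A
    (A ⧸ Ideal.span
      {(X 0 : A) ^ 3, (X 1 : A) ^ 2, (X 2 : A) ^ 2,
       (X 0 : A) * X 1, (X 0 : A) * X 2, (X 1 : A) * X 2})

/-- Setting the variable `X i` to zero. -/
def killVar (i : Fin 3) : A →ₐ[ℚ] A :=
  MvPolynomial.aeval (fun j => if j = i then 0 else (X j : A))

lemma killVar_self (i : Fin 3) : killVar i (X i) = 0 := by simp [killVar]

lemma killVar_ne {i j : Fin 3} (h : j ≠ i) : killVar i (X j) = X j := by simp [killVar, h]

lemma killVar_spec (i : Fin 3) (f : A) : ∃ q : A, f = X i * q + killVar i f := by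
  induction f using MvPolynomial.induction_on with
  | C a => exact ⟨0, by simp [killVar]⟩
  | add p q hp hq =>
    obtain ⟨a, ha⟩ := hp
    obtain ⟨b, hb⟩ := hq
    refine ⟨a + b, ?_⟩
    rw [map_add]
    linear_combination ha + hb
  | mul_X p j hp =>
    obtain ⟨a, ha⟩ := hp
    rw [map_mul]
    by_cases h : j = i
    · subst h
      refine ⟨p, ?_⟩
      rw [killVar_self]
      ring
    · refine ⟨a * X j, ?_⟩
      rw [killVar_ne h]
      linear_combination X j * ha

lemma X_dvd_of_mul {i j : Fin 3} (h : i ≠ j) {a b : A} (hab : X i * a = X j * b) :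
    ∃ c, a = X j * c := by
  have h1 : (X j : A) ∣ X i * a := ⟨b, hab⟩
  rcases (X_prime (R := ℚ) (i := j)).dvd_or_dvd h1 with h2 | h2
  · rw [X_dvd_X] at h2
    exact absurd h2.symm h
  · exact h2

/-- Koszul relation for two variables. -/
lemma koszul_two {i j : Fin 3} (h : i ≠ j) {a b : A} (hab : X i * a + X j * b = 0) :
    ∃ c, a = X j * c ∧ b = - (X i * c) := by
  obtain ⟨c, hc⟩ := X_dvd_of_mul h (a := a) (b := -b) (by linear_combination hab)
  refine ⟨c, hc, ?_⟩
  apply mul_left_cancel₀ (X_ne_zero j : (X j : A) ≠ 0)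
  linear_combination hab - X i * hc

/-- Betti numbers. -/
def betti : ℕ → ℕ
  | 0 => 1
  | 1 => 6
  | 2 => 8
  | 3 => 3
  | _ => 0

/-- The matrices of the minimal free resolution. -/
def resMat : (n : ℕ) → Matrix (Fin (betti n)) (Fin (betti (n + 1))) A
  | 0 => (!![X 2 ^ 2, X 1 * X 2, X 1 ^ 2, X 0 * X 2, X 0 * X 1, X 0 ^ 3] :
      Matrix (Fin 1) (Fin 6) A)
  | 1 => (!![-X 1, 0, -X 0, 0, 0, 0, 0, 0;
             X 2, -X 1, 0, -X 0, -X 0, 0, 0, 0;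
             0, X 2, 0, 0, 0, -X 0, 0, 0;
             0, 0, X 2, X 1, 0, 0, -X 0 ^ 2, 0;
             0, 0, 0, 0, X 2, X 1, 0, -X 0 ^ 2;
             0, 0, 0, 0, 0, 0, X 2, X 1] : Matrix (Fin 6) (Fin 8) A)
  | 2 => (!![-X 0, 0, 0;
             0, -X 0, 0;
             X 1, 0, 0;
             -X 2, 0, X 0 ^ 2;
             0, X 1, -X 0 ^ 2;
             0, -X 2, 0;
             0, 0, X 1;
             0, 0, -X 2] : Matrix (Fin 8) (Fin 3) A)
  | (_ + 3) => 0

/-- The augmentation of the resolution. -/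
def idealM : Ideal A := Ideal.span
      {(X 0 : A) ^ 3, (X 1 : A) ^ 2, (X 2 : A) ^ 2,
       (X 0 : A) * X 1, (X 0 : A) * X 2, (X 1 : A) * X 2}

lemma mulVec0 (v : Fin 6 → A) : (resMat 0).mulVec v =
    ![X 2 ^ 2 * v 0 + X 1 * X 2 * v 1 + X 1 ^ 2 * v 2 + X 0 * X 2 * v 3 + X 0 * X 1 * v 4
      + X 0 ^ 3 * v 5] := by
  change Matrix.mulVec (!![_, _, _, _, _, _] : Matrix (Fin 1) (Fin 6) A) v = _
  ext1 i
  fin_cases i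
  simp [Matrix.mulVec, dotProduct, Fin.sum_univ_six]

lemma mulVec1 (v : Fin 8 → A) : (resMat 1).mulVec v =
    ![-(X 1 * v 0) - X 0 * v 2,
      X 2 * v 0 - X 1 * v 1 - X 0 * v 3 - X 0 * v 4,
      X 2 * v 1 - X 0 * v 5,
      X 2 * v 2 + X 1 * v 3 - X 0 ^ 2 * v 6,
      X 2 * v 4 + X 1 * v 5 - X 0 ^ 2 * v 7,
      X 2 * v 6 + X 1 * v 7] := by
  change Matrix.mulVec (Matrix.of ![_, _, _, _, _, _] : Matrix (Fin 6) (Fin 8) A) v = _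
  ext1 i
  fin_cases i <;> simp [Matrix.mulVec, dotProduct, Fin.sum_univ_eight] <;> ring

lemma mulVec2 (v : Fin 3 → A) : (resMat 2).mulVec v =
    ![-(X 0 * v 0), -(X 0 * v 1), X 1 * v 0, -(X 2 * v 0) + X 0 ^ 2 * v 2,
      X 1 * v 1 - X 0 ^ 2 * v 2, -(X 2 * v 1), X 1 * v 2, -(X 2 * v 2)] := by
  change Matrix.mulVec (Matrix.of ![_, _, _, _, _, _, _, _] : Matrix (Fin 8) (Fin 3) A) v = _
  ext1 i
  fin_cases i <;> simp [Matrix.mulVec, dotProduct, Fin.sum_univ_three] <;> ring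

lemma comp0 (v : Fin 8 → A) :
    (resMat 0).mulVec ((resMat 1).mulVec v) = (0 : Fin 1 → A) := by
  rw [mulVec1]
  erw [mulVec0]
  ext1 i
  fin_cases i
  simp
  ring

lemma comp1 (v : Fin 3 → A) :
    (resMat 1).mulVec ((resMat 2).mulVec v) = (0 : Fin 6 → A) := by
  rw [mulVec2]
  erw [mulVec1]
  ext1 i
  fin_cases i <;> simp <;> ring

lemma resMat_comp (n : ℕ) (v : Fin (betti (n + 2)) → A) :
    (resMat n).mulVec ((resMat (n + 1)).mulVec v) = 0 := by
  match n with
  | 0 => exact comp0 v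
  | 1 => exact comp1 v
  | (k + 2) =>
    change Matrix.mulVec _ (Matrix.mulVec (0 : Matrix _ _ A) v) = 0
    simp

lemma split_two (f : A) (h : killVar 1 (killVar 2 f) = 0) :
    ∃ p q : A, f = X 2 * p + X 1 * q := by
  obtain ⟨p, hp⟩ := killVar_spec 2 f
  obtain ⟨q, hq⟩ := killVar_spec 1 (killVar 2 f)
  refine ⟨p, q, ?_⟩
  linear_combination hp + hq + h

lemma exact1 (a b c d e f : A) (h : X 2 ^ 2 * a + X 1 * X 2 * b + X 1 ^ 2 * c
    + X 0 * X 2 * d + X 0 * X 1 * e + X 0 ^ 3 * f = 0) :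
    ∃ w : Fin 8 → A, (resMat 1).mulVec w = ![a, b, c, d, e, f] := by
  have k22 := killVar_self 2
  have k11 := killVar_self 1
  have k20 : killVar 2 (X 0) = X 0 := killVar_ne (by decide)
  have k21 : killVar 2 (X 1) = X 1 := killVar_ne (by decide)
  have k10 : killVar 1 (X 0) = X 0 := killVar_ne (by decide)
  have hx : (X 0 : A) ≠ 0 := X_ne_zero 0
  have hy : (X 1 : A) ≠ 0 := X_ne_zero 1
  have hz : (X 2 : A) ≠ 0 := X_ne_zero 2
  obtain ⟨w6, w7, h6⟩ : ∃ p q : A, f = X 2 * p + X 1 * q := by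
    apply split_two
    have := congrArg (killVar 1) (congrArg (killVar 2) h)
    simpa [k22, k11, k20, k21, k10, hx] using this
  subst h6
  obtain ⟨d', hd'⟩ : ∃ d', d' = d + X 0 ^ 2 * w6 := ⟨_, rfl⟩
  obtain ⟨e', he'⟩ : ∃ e', e' = e + X 0 ^ 2 * w7 := ⟨_, rfl⟩
  have h2 : X 2 ^ 2 * a + X 1 * X 2 * b + X 1 ^ 2 * c + X 0 * X 2 * d' + X 0 * X 1 * e' = 0 := by
    rw [hd', he']
    linear_combination h
  obtain ⟨w4, w5, h5⟩ : ∃ p q : A, e' = X 2 * p + X 1 * q := by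
    apply split_two
    have h3 := congrArg (killVar 2) h2
    simp only [map_add, map_mul, map_pow, k22, k20, k21, map_zero] at h3
    have h4 : X 0 * killVar 2 e' = X 1 * (- killVar 2 c) := by
      apply mul_left_cancel₀ hy
      linear_combination h3
    obtain ⟨k, hk⟩ := X_dvd_of_mul (by decide) h4
    rw [hk, map_mul, k11, zero_mul]
  obtain ⟨c', hc'⟩ : ∃ c', c' = c + X 0 * w5 := ⟨_, rfl⟩
  have h3 : X 2 ^ 2 * a + X 1 * X 2 * (b + X 0 * w4) + X 1 ^ 2 * c' + X 0 * X 2 * d' = 0 := by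
    rw [hc']
    linear_combination h2 - X 0 * X 1 * h5
  obtain ⟨w1, hw1⟩ : ∃ p, c' = X 2 * p := by
    obtain ⟨p, hp⟩ := killVar_spec 2 c'
    have h4 := congrArg (killVar 2) h3
    have h7 : killVar 2 c' = 0 := by simpa [k22, k20, k21, hy] using h4
    exact ⟨p, by linear_combination hp + h7⟩
  have h4 : X 2 * a + X 1 * (b + X 0 * w4 + X 1 * w1) + X 0 * d' = 0 := by
    apply mul_left_cancel₀ hz
    linear_combination h3 - X 1 ^ 2 * hw1
  obtain ⟨w2, w3, hw3⟩ : ∃ p q : A, d' = X 2 * p + X 1 * q := by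
    apply split_two
    have := congrArg (killVar 1) (congrArg (killVar 2) h4)
    simpa [k22, k11, k20, k21, k10, hx] using this
  have h7 : X 1 * (b + X 0 * w4 + X 1 * w1 + X 0 * w3) + X 2 * (a + X 0 * w2) = 0 := by
    linear_combination h4 - X 0 * hw3
  obtain ⟨w0, hb, ha⟩ := koszul_two (by decide) h7
  refine ⟨![w0, w1, w2, w3, w4, w5, w6, w7], ?_⟩
  rw [mulVec1]
  ext1 i
  fin_cases i
  · simp; linear_combination -ha
  · simp; linear_combination -hb
  · simp; linear_combination hc' - hw1
  · simp; linear_combination hd' - hw3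
  · simp; linear_combination he' - h5
  · simp

lemma exact2 (g : Fin 8 → A) (h : (resMat 1).mulVec g = 0) :
    ∃ w : Fin 3 → A, (resMat 2).mulVec w = g := by
  have hx : (X 0 : A) ≠ 0 := X_ne_zero 0
  have hy : (X 1 : A) ≠ 0 := X_ne_zero 1
  have hz : (X 2 : A) ≠ 0 := X_ne_zero 2
  rw [mulVec1] at h
  have e0 : -(X 1 * g 0) - X 0 * g 2 = 0 := congrFun h (0 : Fin 6)
  have e2 : X 2 * g 1 - X 0 * g 5 = 0 := congrFun h (2 : Fin 6)
  have e3 : X 2 * g 2 + X 1 * g 3 - X 0 ^ 2 * g 6 = 0 := congrFun h (3 : Fin 6)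
  have e4 : X 2 * g 4 + X 1 * g 5 - X 0 ^ 2 * g 7 = 0 := congrFun h (4 : Fin 6)
  have e5 : X 2 * g 6 + X 1 * g 7 = 0 := congrFun h (5 : Fin 6)
  obtain ⟨c3, h6, h7⟩ := koszul_two (by decide) e5
  obtain ⟨c2, h4, h5⟩ := koszul_two (i := 2) (j := 1) (by decide)
    (a := g 4 + X 0 ^ 2 * c3) (b := g 5) (by linear_combination e4 + X 0 ^ 2 * h7)
  obtain ⟨c1, h2, h3⟩ := koszul_two (i := 2) (j := 1) (by decide)
    (a := g 2) (b := g 3 - X 0 ^ 2 * c3) (by linear_combination e3 + X 0 ^ 2 * h6)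
  have h1 : g 1 = -(X 0 * c2) := by
    apply mul_left_cancel₀ hz
    linear_combination e2 + X 0 * h5
  have h0 : g 0 = -(X 0 * c1) := by
    apply mul_left_cancel₀ hy
    linear_combination -e0 - X 0 * h2
  refine ⟨![c1, c2, c3], ?_⟩
  rw [mulVec2]
  ext1 i
  fin_cases i
  · simp [h0]
  · simp [h1]
  · simp [h2]
  · simp; linear_combination -h3
  · simp; linear_combination -h4
  · simp [h5]
  · simp [h6]
  · simp [h7]

lemma exact3 (g : Fin 3 → A) (h : (resMat 2).mulVec g = 0) : g = 0 := by
  have hx : (X 0 : A) ≠ 0 := X_ne_zero 0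
  have hy : (X 1 : A) ≠ 0 := X_ne_zero 1
  rw [mulVec2] at h
  have e0 : -(X 0 * g 0) = 0 := congrFun h (0 : Fin 8)
  have e1 : -(X 0 * g 1) = 0 := congrFun h (1 : Fin 8)
  have e2 : X 1 * g 2 = 0 := congrFun h (6 : Fin 8)
  ext1 i
  fin_cases i
  · simpa [hx] using e0
  · simpa [hx] using e1
  · simpa [hy] using e2

lemma exact0 (f : A) (h : f ∈ idealM) :
    ∃ w : Fin 6 → A, (resMat 0).mulVec w = ![f] := by
  simp only [idealM, Ideal.mem_span_insert, Ideal.mem_span_singleton'] at h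
  obtain ⟨a, _, ⟨b, _, ⟨c, _, ⟨d, _, ⟨e, _, ⟨k, rfl⟩, rfl⟩, rfl⟩, rfl⟩, rfl⟩, rfl⟩ := h
  refine ⟨![c, k, b, e, d, a], ?_⟩
  rw [mulVec0]
  ext1 i
  fin_cases i
  simp
  ring

lemma mem_idealM (w : Fin 6 → A) : (resMat 0).mulVec w (0 : Fin 1) ∈ idealM := by
  rw [mulVec0]
  have h (a : A) (i : A) (hi : i ∈ idealM) : i * a ∈ idealM := Ideal.mul_mem_right _ _ hi
  change _ + _ + _ + _ + _ + _ ∈ idealM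
  refine add_mem (add_mem (add_mem (add_mem (add_mem ?_ ?_) ?_) ?_) ?_) ?_ <;>
    exact h _ _ (Ideal.subset_span (by simp))

lemma resMat_exact (n : ℕ) (g : Fin (betti (n + 1)) → A) (h : (resMat n).mulVec g = 0) :
    ∃ w, (resMat (n + 1)).mulVec w = g := by
  match n with
  | 0 =>
    have h' := (mulVec0 g).symm.trans h
    obtain ⟨w, hw⟩ := exact1 _ _ _ _ _ _ (congrFun h' (0 : Fin 1))
    refine ⟨w, hw.trans ?_⟩
    ext1 i
    change Fin 6 at i
    fin_cases i <;> rfl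
  | 1 => exact exact2 g h
  | 2 =>
    refine ⟨0, ?_⟩
    rw [exact3 g h]
    exact Matrix.mulVec_zero _
  | (k + 3) => exact ⟨0, funext fun i => i.elim0⟩

lemma resMat_minimal (n : ℕ) (i : Fin (betti n)) (j : Fin (betti (n + 1))) :
    MvPolynomial.aeval (fun _ : Fin 3 => (0 : ℚ)) (resMat n i j) = 0 := by
  match n with
  | 0 =>
    change Fin 1 at i
    change Fin 6 at j
    fin_cases i; fin_cases j <;> simp [resMat]
  | 1 =>
    change Fin 6 at i
    change Fin 8 at j
    fin_cases i <;> fin_cases j <;> simp [resMat]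
  | 2 =>
    change Fin 8 at i
    change Fin 3 at j
    fin_cases i <;> fin_cases j <;> simp [resMat]
  | (k + 3) =>
    change MvPolynomial.aeval _ ((0 : Matrix _ _ A) i j) = 0
    simp

/-- The objects of the resolution. -/
abbrev resX (n : ℕ) : ModuleCat A := ModuleCat.of A (Fin (betti n) → A)

/-- The differentials of the resolution. -/
def resD (n : ℕ) : resX (n + 1) ⟶ resX n := ModuleCat.ofHom (resMat n).mulVecLin

lemma resD_comp (n : ℕ) : resD (n + 1) ≫ resD n = 0 := by
  ext1
  apply LinearMap.ext
  intro v
  exact resMat_comp n v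

/-- The resolution. -/
def resC : ChainComplex (ModuleCat A) ℕ := ChainComplex.of resX resD resD_comp

lemma resC_d (n : ℕ) : resC.d (n + 1) n = resD n := ChainComplex.of_d _ _ _

/-- The augmentation of the resolution. -/
def resAug : resX 0 ⟶ M18 :=
  ModuleCat.ofHom ((Submodule.mkQ idealM).comp (LinearMap.proj (R := A) (φ := fun _ => A) (0 : Fin 1)))

lemma resAug_comp : resC.d 1 0 ≫ resAug = 0 := by
  rw [resC_d 0]
  ext1
  apply LinearMap.ext
  intro v
  exact (Submodule.Quotient.mk_eq_zero idealM).2 (mem_idealM v)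

/-- The augmentation as a chain map. -/
def resπ : resC ⟶ (ChainComplex.single₀ (ModuleCat A)).obj M18 :=
  (ChainComplex.toSingle₀Equiv _ _).symm ⟨resAug, resAug_comp⟩

lemma resπ_f_zero : resπ.f 0 = resAug := ChainComplex.toSingle₀Equiv_symm_apply_f_zero _ _

lemma aug_exact : (ShortComplex.mk (resC.d 1 0) resAug resAug_comp).Exact := by
  rw [ShortComplex.moduleCat_exact_iff]
  intro v hv
  change Fin 1 → A at v
  have hv' : v 0 ∈ idealM := (Submodule.Quotient.mk_eq_zero idealM).1 hv
  obtain ⟨w, hw⟩ := exact0 _ hv'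
  refine ⟨w, ?_⟩
  change (resC.d 1 0).hom w = v
  rw [resC_d 0]
  refine hw.trans ?_
  ext1 i
  fin_cases i
  rfl

lemma aug_epi : Epi resAug := by
  rw [ModuleCat.epi_iff_surjective]
  intro m
  obtain ⟨f, hf⟩ := Submodule.mkQ_surjective idealM m
  exact ⟨(fun _ => f : Fin 1 → A), hf⟩

lemma resC_exactAt (n : ℕ) : resC.ExactAt (n + 1) := by
  rw [HomologicalComplex.exactAt_iff' _ (n + 2) (n + 1) n (by simp) (by simp)]
  rw [ShortComplex.moduleCat_exact_iff]
  intro v hv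
  change (resC.d (n + 1) n).hom v = 0 at hv
  rw [resC_d n] at hv
  obtain ⟨w, hw⟩ := resMat_exact n v hv
  refine ⟨w, ?_⟩
  change (resC.d (n + 1 + 1) (n + 1)).hom w = v
  rw [resC_d (n + 1)]
  exact hw

lemma resπ_quasiIso : QuasiIso resπ where
  quasiIsoAt n := by
    cases n with
    | zero =>
      rw [ChainComplex.quasiIsoAt₀_iff, ShortComplex.quasiIso_iff_of_zeros']
      · refine (ShortComplex.exact_and_epi_g_iff_of_iso ?_).2 ⟨aug_exact, aug_epi⟩
        exact ShortComplex.isoMk (Iso.refl _) (Iso.refl _) (Iso.refl _)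
          ((Category.id_comp (resC.d 1 0)).trans (Category.comp_id (resC.d 1 0)).symm)
          (by
            change 𝟙 _ ≫ resAug = resπ.f 0 ≫ 𝟙 _
            rw [resπ_f_zero, Category.id_comp]
            exact (Category.comp_id _).symm)
      all_goals rfl
    | succ n =>
      rw [quasiIsoAt_iff_exactAt']
      · exact resC_exactAt n
      · apply ChainComplex.exactAt_succ_single_obj

/-- The minimal free resolution of `M18`. -/
def resP : ProjectiveResolution M18 where
  complex := resC
  projective n := by
    change Projective (ModuleCat.of A (Fin (betti n) → A))
    infer_instance
  π := resπ
  quasiIso := resπ_quasiIso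

open MonoidalCategory TensorProduct

lemma smul_rat (a : A) (q : ℚ) : a • q = MvPolynomial.aeval (fun _ : Fin 3 => (0 : ℚ)) a * q := rfl

lemma tensor_resD (n : ℕ) :
    ((tensoringLeft (ModuleCat A)).obj (ModuleCat.of A ℚ)).map (resD n) = 0 := by
  ext1
  change LinearMap.lTensor ℚ (resMat n).mulVecLin = 0
  apply TensorProduct.ext'
  intro q v
  rw [LinearMap.lTensor_tmul]
  apply (TensorProduct.piScalarRight A A ℚ (Fin (betti n))).injective
  rw [TensorProduct.piScalarRight_apply, TensorProduct.piScalarRightHom_tmul]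
  ext1 i
  simp only [Matrix.mulVecLin_apply, smul_rat, Matrix.mulVec, dotProduct, map_sum, map_mul,
    resMat_minimal]
  simp

/-- Computation of Tor. -/
def torIso (n : ℕ) : ((Tor (ModuleCat A) n).obj (ModuleCat.of A ℚ)).obj M18 ≅
    (ModuleCat.of A ℚ) ⊗ resX n :=
  resP.isoLeftDerivedObj ((tensoringLeft (ModuleCat A)).obj (ModuleCat.of A ℚ)) n ≪≫
  (ShortComplex.HomologyData.ofZeros
    ((((tensoringLeft (ModuleCat A)).obj (ModuleCat.of A ℚ)).mapHomologicalComplex _).obj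
      resP.complex |>.sc n)
    (by
      change ((tensoringLeft (ModuleCat A)).obj (ModuleCat.of A ℚ)).map (resC.d _ n) = 0
      rw [ChainComplex.prev, resC_d]
      exact tensor_resD n)
    (by
      change ((tensoringLeft (ModuleCat A)).obj (ModuleCat.of A ℚ)).map (resC.d n _) = 0
      cases n with
      | zero =>
        rw [resC.shape, Functor.map_zero]
        simp
      | succ n =>
        rw [ChainComplex.next_nat_succ, resC_d]
        exact tensor_resD n)).left.homologyIso

/-- Linear version. -/
def torEquiv (n : ℕ) : ((Tor (ModuleCat A) n).obj (ModuleCat.of A ℚ)).obj M18 ≃ₗ[A]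
    (Fin (betti n) → ℚ) :=
  (torIso n).toLinearEquiv.trans (TensorProduct.piScalarRight A A ℚ (Fin (betti n)))

/-- Rational version. -/
def torQEquiv (n : ℕ) : TorQ n M18 ≃ₗ[ℚ] (Fin (betti n) → ℚ) where
  toFun := torEquiv n
  invFun := (torEquiv n).symm
  left_inv := (torEquiv n).left_inv
  right_inv := (torEquiv n).right_inv
  map_add' := (torEquiv n).map_add
  map_smul' q x := by
    refine ((torEquiv n).map_smul (algebraMap ℚ A q) x).trans ?_
    ext1 i
    simp only [Pi.smul_apply, smul_rat]
    simp

/-- `Tor_j^A(ℚ, A/(e₁³, e₂², e₃², e₁e₂, e₁e₃, e₂e₃))` has `ℚ`-dimension `1, 6, 8, 3` for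
`j = 0, 1, 2, 3` and vanishes for `j ≥ 4`. -/
theorem statement18 :
    Module.finrank ℚ (TorQ 0 M18) = 1 ∧
    Module.finrank ℚ (TorQ 1 M18) = 6 ∧
    Module.finrank ℚ (TorQ 2 M18) = 8 ∧
    Module.finrank ℚ (TorQ 3 M18) = 3 ∧
    ∀ j : ℕ, 4 ≤ j → Subsingleton (TorQ j M18) := by
  refine ⟨?_, ?_, ?_, ?_, ?_⟩
  · rw [(torQEquiv 0).finrank_eq, Module.finrank_fin_fun, betti]
  · rw [(torQEquiv 1).finrank_eq, Module.finrank_fin_fun, betti]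
  · rw [(torQEquiv 2).finrank_eq, Module.finrank_fin_fun, betti]
  · rw [(torQEquiv 3).finrank_eq, Module.finrank_fin_fun, betti]
  · intro j hj
    obtain ⟨k, rfl⟩ := Nat.exists_eq_add_of_le' hj
    have : Subsingleton (Fin (betti (k + 4)) → ℚ) := ⟨fun a b => funext fun i => Fin.elim0 i⟩
    exact (torQEquiv (k + 4)).toEquiv.subsingleton

end
end
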